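/- Let n ∈ ℕ, E a complex Banach space, s ∈ ℝ, 0 < p < ∞, 0 < q ≤ ∞, d > 1. Let K ∈ ℕ₀ and L ∈ ℤ with L ≥ −1 satisfy K ≥ 1 + ⌊s⌋ and L ≥ ⌊σ_{p,q} − s⌋. Then there is a constant c > 0 such that: every f ∈ S'(ℝ^n,E) which can be represented as f = Σ_{ν=0}^∞ Σ_{m∈ℤ^n} λ_{ν,m} a_{ν,m} with convergence in S'(ℝ^n,E), where each a_{0,m} is an E-valued 1_K-atom supported in d·Q_{0,m} and each a_{ν,m} (ν ≥ 1) is an E-valued (s,p)_{K,L}-atom associated with Q_{ν,m}, and where λ ∈ f_{p,q}, belongs to F^s_{p,q}(E) and satisfies ‖f|F^s_{p,q}(E)‖ ≤ c ‖λ|f_{p,q}‖. The constant c is independent of f, of the coefficients λ and of the atoms a_{ν,m}, i.e. of the chosen representation. -/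

import Mathlib

noncomputable section

open MeasureTheory Filter Metric Real Set SchwartzMap
open scoped ENNReal NNReal Topology FourierTransform

/-- Euclidean space ℝⁿ. -/
abbrev Rn (n : ℕ) : Type := EuclideanSpace ℝ (Fin n)

/-- The Schwartz space 𝓢(ℝⁿ, ℂ). -/
abbrev Sch (n : ℕ) : Type := SchwartzMap (Rn n) ℂ

/-- Partial derivative in the `i`-th coordinate direction. -/
def pd {F : Type*} [NormedAddCommGroup F] [NormedSpace ℝ F] {n : ℕ} (i : Fin n)
    (g : Rn n → F) : Rn n → F :=
  fun x => lineDeriv ℝ g x (EuclideanSpace.single i (1 : ℝ))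

/-- Multi-index derivative `D^α = ∂₁^{α₁} ⋯ ∂ₙ^{αₙ}`. -/
def mderiv {F : Type*} [NormedAddCommGroup F] [NormedSpace ℝ F] {n : ℕ} (α : Fin n → ℕ)
    (g : Rn n → F) : Rn n → F :=
  (List.finRange n).foldr (fun i h => (pd i)^[α i] h) g

/-- The order `|α|` of a multi-index. -/
def mdeg {n : ℕ} (α : Fin n → ℕ) : ℕ := ∑ i, α i

/-- The Schwartz seminorm `‖φ‖_{K,L} = sup_x (1+|x|²)^{K/2} ∑_{|α| ≤ L} |D^α φ(x)|`. -/
def schSemi {n : ℕ} (K L : ℕ) (φ : Sch n) : ℝ :=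
  ⨆ x : Rn n, (1 + ‖x‖ ^ 2) ^ ((K : ℝ) / 2) *
    ∑ α : Fin n → Fin (L + 1), if mdeg (fun i => (α i : ℕ)) ≤ L
      then ‖mderiv (fun i => (α i : ℕ)) (fun y => φ y) x‖ else 0

/-- `E`-valued tempered distributions: linear maps `𝓢(ℝⁿ) → E` bounded by some
Schwartz seminorm. -/
structure TDist (n : ℕ) (E : Type*) [NormedAddCommGroup E] [NormedSpace ℂ E] where
  toFun : Sch n →ₗ[ℂ] E
  bound : ∃ (c : ℝ) (K L : ℕ), ∀ φ : Sch n, ‖toFun φ‖ ≤ c * schSemi K L φ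

namespace Aux

lemma hasTemperateGrowth_sub_left {n : ℕ} (x : Rn n) :
    Function.HasTemperateGrowth (fun y : Rn n => x - y) := by
  apply Function.HasTemperateGrowth.of_fderiv (k := 1) (C := ‖x‖ + 1)
  · have h : (fderiv ℝ (fun y : Rn n => x - y)) =
        fun _ : Rn n => -(ContinuousLinearMap.id ℝ (Rn n)) := by
      ext1 y
      rw [fderiv_const_sub]
      simp
    rw [h]
    exact .const _
  · exact (differentiable_const x).sub differentiable_id
  · intro y
    have h1 : ‖x - y‖ ≤ ‖x‖ + ‖y‖ := norm_sub_le x y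
    have h2 : (0:ℝ) ≤ ‖y‖ := norm_nonneg y
    have h3 : (0:ℝ) ≤ ‖x‖ := norm_nonneg x
    calc ‖x - y‖ ≤ ‖x‖ + ‖y‖ := h1
      _ ≤ (‖x‖ + 1) * (1 + ‖y‖) ^ 1 := by nlinarith

lemma antilipschitz_sub_left {n : ℕ} (x : Rn n) :
    AntilipschitzWith 1 (fun y : Rn n => x - y) := by
  refine (Isometry.antilipschitz ?_)
  intro y z
  simp only [edist_dist, dist_eq_norm, sub_sub_sub_cancel_left, norm_sub_rev]

end Aux

/-- The Schwartz function `y ↦ ψ(x - y)`. -/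
def shiftReflect {n : ℕ} (ψ : Sch n) (x : Rn n) : Sch n :=
  SchwartzMap.compCLMOfAntilipschitz (𝕜 := ℝ)
    (Aux.hasTemperateGrowth_sub_left x) (Aux.antilipschitz_sub_left x) ψ

/-- The dilated Schwartz function `ψ(t ·)` (junk value `0` when `t = 0`). -/
def dilate {n : ℕ} (ψ : Sch n) (t : ℝ) : Sch n :=
  if h : t = 0 then 0 else
    SchwartzMap.compCLM (𝕜 := ℝ) (g := fun y : Rn n => t • y)
      (by
        have := (t • ContinuousLinearMap.id ℝ (Rn n)).hasTemperateGrowth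
        exact this)
      (⟨1, |t|⁻¹, fun y => by
        have ht : 0 < |t| := abs_pos.mpr h
        have : ‖t • y‖ = |t| * ‖y‖ := by rw [norm_smul]; simp [Real.norm_eq_abs]
        rw [pow_one, this]
        rw [mul_add, mul_one]
        have : |t|⁻¹ * (|t| * ‖y‖) = ‖y‖ := by field_simp
        nlinarith [norm_nonneg y, inv_pos.mpr ht]⟩) ψ

/-- Fourier transform on Schwartz space. -/
def fourierS {n : ℕ} (φ : Sch n) : Sch n := FourierTransform.fourierCLE ℂ (Sch n) φ

/-- Inverse Fourier transform on Schwartz space. -/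
def invFourierS {n : ℕ} (φ : Sch n) : Sch n := (FourierTransform.fourierCLE ℂ (Sch n)).symm φ

variable {n : ℕ} {E : Type*} [NormedAddCommGroup E] [NormedSpace ℂ E]

/-- Convolution `(ψ * f)(x) := (2π)^{-n/2} f(ψ(x - ·))` of a Schwartz function with an
`E`-valued tempered distribution. -/
def tdConv (ψ : Sch n) (f : TDist n E) : Rn n → E :=
  fun x => ((2 * π) ^ (-(n : ℝ) / 2) : ℝ) • f.toFun (shiftReflect ψ x)

/-- The operator `f ↦ (φ f̂)ˇ = φ̌ * f`. -/
def mOp (φ : Sch n) (f : TDist n E) : Rn n → E := tdConv (invFourierS φ) f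

/-- `L_p`-norm (in `[0,∞]`) of an `ℝ≥0∞`-valued function. -/
def lpNormENN {n : ℕ} (p : ℝ≥0∞) (g : Rn n → ℝ≥0∞) : ℝ≥0∞ :=
  if p = ∞ then essSup g volume else (∫⁻ x, (g x) ^ p.toReal) ^ (1 / p.toReal)

/-- `ℓ_q`-norm (in `[0,∞]`) of a sequence, with the usual modification for `q = ∞`. -/
def lqSum (q : ℝ≥0∞) (a : ℕ → ℝ≥0∞) : ℝ≥0∞ :=
  if q = ∞ then ⨆ j, a j else (∑' j, (a j) ^ q.toReal) ^ (1 / q.toReal)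

/-- A smooth dyadic resolution of unity. -/
structure SmoothResolution (n : ℕ) (φ : ℕ → Sch n) : Prop where
  supp0 : Function.support (φ 0) ⊆ {ξ : Rn n | ‖ξ‖ ≤ 2}
  suppj : ∀ j : ℕ, 0 < j →
    Function.support (φ j) ⊆ {ξ : Rn n | 2 ^ ((j : ℝ) - 1) ≤ ‖ξ‖ ∧ ‖ξ‖ ≤ 2 ^ ((j : ℝ) + 1)}
  sum_eq : ∀ ξ : Rn n, ∑' j : ℕ, φ j ξ = 1
  deriv_bound : ∀ α : Fin n → ℕ, ∃ c : ℝ, ∀ (j : ℕ) (ξ : Rn n),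
    ‖mderiv α (fun y => φ j y) ξ‖ ≤ c * 2 ^ (-(j : ℝ) * (mdeg α : ℝ))

/-- The Besov quasi-norm `‖f | B^s_{p,q}(E)‖` w.r.t. the resolution of unity `φ`. -/
def besovNorm (s : ℝ) (p q : ℝ≥0∞) (φ : ℕ → Sch n) (f : TDist n E) : ℝ≥0∞ :=
  lqSum q fun j => (2 : ℝ≥0∞) ^ ((j : ℝ) * s) * eLpNorm (mOp (φ j) f) p volume

/-- The Triebel–Lizorkin quasi-norm `‖f | F^s_{p,q}(E)‖` w.r.t. the resolution of unity `φ`. -/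
def triebelNorm (s : ℝ) (p q : ℝ≥0∞) (φ : ℕ → Sch n) (f : TDist n E) : ℝ≥0∞ :=
  lpNormENN p fun x =>
    lqSum q fun j => (2 : ℝ≥0∞) ^ ((j : ℝ) * s) * (‖mOp (φ j) f x‖₊ : ℝ≥0∞)

/-- The closed cube `d·Q_{ν,m}` with centre `2^{-ν}m` and side length `d·2^{-ν}`. -/
def dQ {n : ℕ} (d : ℝ) (ν : ℕ) (m : Fin n → ℤ) : Set (Rn n) :=
  {x : Rn n | ∀ i, |x i - 2 ^ (-(ν : ℝ)) * (m i : ℝ)| ≤ d * 2 ^ (-(ν : ℝ)) / 2}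

/-- The lattice point `m ∈ ℤⁿ` as a point of `ℝⁿ`. -/
def zpt {n : ℕ} (m : Fin n → ℤ) : Rn n := WithLp.toLp 2 fun i => (m i : ℝ)

/-- `σ_p = n(1/p - 1)_+`. -/
def sigmaP (n : ℕ) (p : ℝ≥0∞) : ℝ := max ((n : ℝ) * (1 / p.toReal - 1)) 0

/-- `σ_{p,q} = n(1/min(p,q) - 1)_+`. -/
def sigmaPQ (n : ℕ) (p q : ℝ≥0∞) : ℝ := max ((n : ℝ) * (1 / (min p q).toReal - 1)) 0

/-- An `E`-valued `1_K`-atom supported in `d·Q_{0,m}`. -/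
def Is1Atom {n : ℕ} {E : Type*} [NormedAddCommGroup E] [NormedSpace ℝ E]
    (K : ℕ) (d : ℝ) (m : Fin n → ℤ) (a : Rn n → E) : Prop :=
  ContDiff ℝ K a ∧ Function.support a ⊆ dQ d 0 m ∧
    ∀ α : Fin n → ℕ, mdeg α ≤ K → ∀ x, ‖mderiv α a x‖ ≤ 1

/-- An `E`-valued `(s,p)_{K,L}`-atom associated with the cube `Q_{ν,m}` (support in
`d·Q_{ν,m}`, derivative bounds, and moment conditions up to order `L`). -/
def IsSPAtom {n : ℕ} {E : Type*} [NormedAddCommGroup E] [NormedSpace ℝ E]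
    (s : ℝ) (p : ℝ≥0∞) (K : ℕ) (L : ℤ) (d : ℝ) (ν : ℕ) (m : Fin n → ℤ)
    (a : Rn n → E) : Prop :=
  ContDiff ℝ K a ∧ Function.support a ⊆ dQ d ν m ∧
    (∀ α : Fin n → ℕ, mdeg α ≤ K → ∀ x,
      ‖mderiv α a x‖ ≤ 2 ^ (-(ν : ℝ) * (s - (n : ℝ) / p.toReal) + (mdeg α : ℝ) * (ν : ℝ))) ∧
    ∀ β : Fin n → ℕ, (mdeg β : ℤ) ≤ L →
      (∫ x : Rn n, (∏ i, (x i) ^ (β i)) • a x) = 0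

/-- The sequence space norm `‖λ|b_{p,q}‖`. -/
def bNorm {n : ℕ} (p q : ℝ≥0∞) (lam : ℕ → (Fin n → ℤ) → ℂ) : ℝ≥0∞ :=
  lqSum q fun ν =>
    if p = ∞ then ⨆ m : Fin n → ℤ, (‖lam ν m‖₊ : ℝ≥0∞)
    else (∑' m : Fin n → ℤ, (‖lam ν m‖₊ : ℝ≥0∞) ^ p.toReal) ^ (1 / p.toReal)

open Classical in
/-- The `L_p`-normalised characteristic function `χ^{(p)}_{ν,m}` of `Q_{ν,m}`. -/
def chiP {n : ℕ} (p : ℝ≥0∞) (ν : ℕ) (m : Fin n → ℤ) (x : Rn n) : ℝ≥0∞ :=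
  if x ∈ dQ 1 ν m then (2 : ℝ≥0∞) ^ ((ν : ℝ) * (n : ℝ) / p.toReal) else 0

/-- The sequence space norm `‖λ|f_{p,q}‖`. -/
def fNorm {n : ℕ} (p q : ℝ≥0∞) (lam : ℕ → (Fin n → ℤ) → ℂ) : ℝ≥0∞ :=
  lpNormENN p fun x =>
    if q = ∞ then ⨆ (ν : ℕ) (m : Fin n → ℤ), (‖lam ν m‖₊ : ℝ≥0∞) * chiP p ν m x
    else (∑' (ν : ℕ) (m : Fin n → ℤ),
      ((‖lam ν m‖₊ : ℝ≥0∞) * chiP p ν m x) ^ q.toReal) ^ (1 / q.toReal)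

/-- `f = ∑_{ν,m} λ_{ν,m} a_{ν,m}` with unconditional convergence in `S'(ℝⁿ,E)`:
for every test function the pairings sum to `f(φ)`. -/
def RepresentsAtomic {n : ℕ} {E : Type*} [NormedAddCommGroup E] [NormedSpace ℂ E]
    (f : TDist n E) (lam : ℕ → (Fin n → ℤ) → ℂ)
    (a : ℕ → (Fin n → ℤ) → Rn n → E) : Prop :=
  ∀ φ : Sch n, HasSum
    (fun νm : ℕ × (Fin n → ℤ) => lam νm.1 νm.2 • ∫ x : Rn n, φ x • a νm.1 νm.2 x)
    (f.toFun φ)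

section TLDeriv
variable {F : Type*} [NormedAddCommGroup F] [NormedSpace ℝ F]

def tlD (l : List (Fin n)) (g : Rn n → F) : Rn n → F := l.foldr (fun i h => pd i h) g

lemma tl_pd_eq {g : Rn n → F} (hg : Differentiable ℝ g) (i : Fin n) :
    pd i g = fun x => fderiv ℝ g x (EuclideanSpace.single i (1:ℝ)) := by
  funext x
  exact (hg x).lineDeriv_eq_fderiv

lemma tl_pd_contDiff {g : Rn n → F} {k : ℕ} (hg : ContDiff ℝ (k + 1 : ℕ) g) (i : Fin n) :
    ContDiff ℝ k (pd i g) := by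
  rw [tl_pd_eq (hg.differentiable (by simp))]
  exact (hg.fderiv_right (m := k) (by norm_cast)).clm_apply contDiff_const

lemma tl_D_contDiff (l : List (Fin n)) {g : Rn n → F} {k : ℕ}
    (hg : ContDiff ℝ (k + l.length : ℕ) g) : ContDiff ℝ k (tlD l g) := by
  induction l generalizing k with
  | nil => simpa [tlD] using hg
  | cons i l ih =>
    apply tl_pd_contDiff (g := tlD l g)
    apply ih
    convert hg using 2
    simp; ring

lemma tl_pd_comm {g : Rn n → F} (hg : ContDiff ℝ 2 g) (i j : Fin n) :
    pd i (pd j g) = pd j (pd i g) := by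
  have h1 : Differentiable ℝ g := hg.differentiable (by simp)
  have h2 : ContDiff ℝ 1 (fderiv ℝ g) := hg.fderiv_right (by norm_num)
  have h3 : Differentiable ℝ (fderiv ℝ g) := h2.differentiable (by simp)
  have key : ∀ i j : Fin n, pd i (pd j g) = fun x => fderiv ℝ (fderiv ℝ g) x
      (EuclideanSpace.single i (1:ℝ)) (EuclideanSpace.single j (1:ℝ)) := by
    intro i j
    rw [tl_pd_eq h1, tl_pd_eq (by fun_prop)]
    funext x
    rw [fderiv_clm_apply (h3 x) (by fun_prop)]
    simp
  rw [key, key]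
  funext x
  exact (hg.contDiffAt.isSymmSndFDerivAt (by simp)) _ _

lemma tl_D_perm {l1 l2 : List (Fin n)} (h : l1.Perm l2) {g : Rn n → F}
    (hg : ContDiff ℝ (l1.length : ℕ) g) : tlD l1 g = tlD l2 g := by
  induction h with
  | nil => rfl
  | cons x h ih =>
    have := ih (hg.of_le (by simp))
    simp only [tlD, List.foldr_cons] at this ⊢
    rw [this]
  | swap x y l =>
    have : ContDiff ℝ 2 (tlD l g) := by
      apply tl_D_contDiff l (k := 2)
      convert hg using 2
      simp; ring
    exact tl_pd_comm this y x
  | trans h1 h2 ih1 ih2 =>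
    rw [ih1 hg, ih2 (by rwa [← h1.length_eq])]

lemma tl_mderiv_eq (α : Fin n → ℕ) (g : Rn n → F) :
    mderiv α g = tlD ((List.finRange n).flatMap (fun i => List.replicate (α i) i)) g := by
  unfold mderiv
  induction (List.finRange n) with
  | nil => rfl
  | cons i l ih =>
    simp only [List.foldr_cons, List.flatMap_cons, tlD, List.foldr_append] at ih ⊢
    rw [ih]
    generalize List.foldr _ g _ = G
    induction α i with
    | zero => rfl
    | succ k ihk => rw [Function.iterate_succ_apply', ihk]; rfl

lemma tl_exists_mderiv (l : List (Fin n)) {g : Rn n → F}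
    (hg : ContDiff ℝ (l.length : ℕ) g) :
    ∃ α : Fin n → ℕ, mdeg α = l.length ∧ mderiv α g = tlD l g := by
  have hperm : l.Perm ((List.finRange n).flatMap (fun i => List.replicate (l.count i) i)) := by
    rw [List.perm_iff_count]
    intro a
    rw [List.count_flatMap]
    have : (List.map (List.count a ∘ fun i => List.replicate (List.count i l) i)
        (List.finRange n)).sum = ∑ i : Fin n, List.count a (List.replicate (l.count i) i) := by
      rw [← List.ofFn_eq_map, List.sum_ofFn]; rfl
    rw [this]
    simp [List.count_replicate]
  refine ⟨fun i => l.count i, ?_, ?_⟩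
  · rw [hperm.length_eq, List.length_flatMap, mdeg, ← List.ofFn_eq_map, List.sum_ofFn]
    simp
  · rw [tl_mderiv_eq, tl_D_perm hperm hg]

lemma tl_D_eq (l : List (Fin n)) {g : Rn n → F} (hg : ContDiff ℝ (l.length : ℕ) g) (x : Rn n) :
    tlD l g x = iteratedFDeriv ℝ l.length g x
      (fun j => EuclideanSpace.single (l.get j) (1:ℝ)) := by
  induction l generalizing x with
  | nil => simp [tlD]
  | cons i l ih =>
    have hg' : ContDiff ℝ (l.length : ℕ) g := hg.of_le (by simp)
    have h0 : tlD l g = fun x => iteratedFDeriv ℝ l.length g x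
      (fun j => EuclideanSpace.single (l.get j) (1:ℝ)) := funext (ih hg')
    have hd : Differentiable ℝ (iteratedFDeriv ℝ l.length g) :=
      hg.differentiable_iteratedFDeriv (by simp; norm_cast; omega)
    have h1 : tlD (i :: l) g = pd i (tlD l g) := rfl
    rw [h1, tl_pd_eq (by rw [h0]; exact fun x => (hd x).continuousMultilinear_apply_const _)]
    simp only [List.length_cons]
    rw [(hd x).iteratedFDeriv_succ_apply_left', h0]
    rfl

lemma tl_multi_expand {k : ℕ} (T : (Rn n) [×k]→L[ℝ] F) (v : Fin k → Rn n) :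
    T v = ∑ c : Fin k → Fin n, (∏ i, v i (c i)) •
      T (fun i => EuclideanSpace.single (c i) (1:ℝ)) := by
  have : v = fun i => ∑ c : Fin n, v i c • EuclideanSpace.single c (1:ℝ) := by
    funext i
    ext c
    simp [Finset.sum_apply, Pi.single_apply]
  conv_lhs => rw [this]
  rw [T.map_sum]
  refine Finset.sum_congr rfl fun c _ => ?_
  exact T.map_smul_univ (fun i => v i (c i)) _

lemma tl_multi_norm {k : ℕ} (T : (Rn n) [×k]→L[ℝ] F) {B : ℝ} (hB : 0 ≤ B)
    (h : ∀ c : Fin k → Fin n, ‖T (fun i => EuclideanSpace.single (c i) (1:ℝ))‖ ≤ B) :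
    ‖T‖ ≤ (n:ℝ) ^ k * B := by
  refine T.opNorm_le_bound (by positivity) fun v => ?_
  rw [tl_multi_expand T v]
  calc _ ≤ ∑ c : Fin k → Fin n, ‖(∏ i, v i (c i)) •
      T (fun i => EuclideanSpace.single (c i) (1:ℝ))‖ := norm_sum_le _ _
    _ ≤ ∑ c : Fin k → Fin n, (∏ i, ‖v i‖) * B := by
      refine Finset.sum_le_sum fun c _ => ?_
      rw [norm_smul, norm_prod]
      refine mul_le_mul ?_ (h c) (norm_nonneg _) (by positivity)
      exact Finset.prod_le_prod (fun _ _ => norm_nonneg _)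
        fun i _ => PiLp.norm_apply_le (v i) (c i)
    _ = _ := by simp; ring

lemma tl_norm_iteratedFDeriv_le {g : Rn n → F} {k : ℕ} (hg : ContDiff ℝ k g) {B : ℝ} (hB : 0 ≤ B)
    {x : Rn n} (h : ∀ α : Fin n → ℕ, mdeg α = k → ‖mderiv α g x‖ ≤ B) :
    ‖iteratedFDeriv ℝ k g x‖ ≤ (n:ℝ) ^ k * B := by
  refine tl_multi_norm _ hB fun c => ?_
  have hlen : (List.ofFn c).length = k := by simp
  have hg' : ContDiff ℝ ((List.ofFn c).length : ℕ) g := by rwa [hlen]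
  obtain ⟨α, h1, h2⟩ := tl_exists_mderiv (List.ofFn c) hg'
  have h3 := tl_D_eq (List.ofFn c) hg' x
  have h4 : tlD (List.ofFn c) g x = iteratedFDeriv ℝ k g x
      (fun i => EuclideanSpace.single (c i) (1:ℝ)) := by
    rw [h3]
    have : ∀ (m : ℕ) (hm : m = k) (u : Fin m → Rn n) (w : Fin k → Rn n),
      (∀ i, u i = w (Fin.cast hm i)) → iteratedFDeriv ℝ m g x u = iteratedFDeriv ℝ k g x w := by
      intro m hm u w huw
      subst hm
      congr 1
      funext i
      exact huw i
    apply this _ hlen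
    intro i
    simp only [List.get_eq_getElem, List.getElem_ofFn]
    rfl
  rw [← h4, ← h2]
  exact h α (by rw [h1, hlen])

lemma tl_taylor [CompleteSpace F] {g : Rn n → F} {k : ℕ} (hg : ContDiff ℝ k g) (x y : Rn n) {B : ℝ}
    (h : ∀ θ ∈ Set.Icc (0:ℝ) 1, ‖iteratedFDeriv ℝ k g (x + θ • y)‖ ≤ B) :
    ‖g (x + y) - ∑ l ∈ Finset.range k, ((Nat.factorial l : ℝ))⁻¹ •
      iteratedFDeriv ℝ l g x (fun _ => y)‖ ≤ B * ‖y‖ ^ k := by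
  have hB : 0 ≤ B := (norm_nonneg _).trans (h 0 (by simp))
  cases k with
  | zero => simpa using h 1 (by simp)
  | succ k =>
    rw [map_add_eq_sum_add_integral_iteratedFDeriv (n := k) (f := g) (x := x) (y := y)
      (fun t _ => by exact_mod_cast hg.contDiffAt)]
    rw [add_sub_cancel_left, norm_smul]
    have h1 : ‖∫ t in (0:ℝ)..1, (1 - t)^k • iteratedFDeriv ℝ (k + 1) g (x + t • y) (fun _ ↦ y)‖
        ≤ (B * ‖y‖ ^ (k+1)) * |1 - 0| := by
      apply intervalIntegral.norm_integral_le_of_norm_le_const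
      intro t ht
      rw [Set.uIoc_of_le zero_le_one] at ht
      rw [norm_smul]
      have h2 : ‖(1 - t)^k‖ ≤ 1 := by
        rw [norm_pow, Real.norm_eq_abs, abs_of_nonneg (by linarith [ht.2])]
        exact pow_le_one₀ (by linarith [ht.2]) (by linarith [ht.1])
      have h3 : ‖iteratedFDeriv ℝ (k + 1) g (x + t • y) (fun _ ↦ y)‖ ≤ B * ‖y‖ ^ (k+1) := by
        refine (ContinuousMultilinearMap.le_opNorm _ _).trans ?_
        simp only [Finset.prod_const, Finset.card_univ, Fintype.card_fin]
        exact mul_le_mul_of_nonneg_right (h t ⟨ht.1.le, ht.2⟩) (by positivity)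
      calc _ ≤ 1 * (B * ‖y‖ ^ (k+1)) := by gcongr
        _ = _ := one_mul _
    have h4 : ‖((Nat.factorial k : ℝ))⁻¹‖ ≤ 1 := by
      rw [norm_inv]
      apply inv_le_one_of_one_le₀
      simp only [RCLike.norm_natCast]
      exact_mod_cast Nat.one_le_iff_ne_zero.mpr (Nat.factorial_ne_zero k)
    calc _ ≤ 1 * ((B * ‖y‖ ^ (k+1)) * |1 - 0|) := by gcongr
      _ = _ := by simp
end TLDeriv

section TLKernel

lemma tl_dilate_apply (ψ : Sch n) {t : ℝ} (ht : t ≠ 0) (x : Rn n) :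
    dilate ψ t x = ψ (t • x) := by
  unfold dilate
  rw [dif_neg ht]
  rfl

lemma tl_shiftReflect_apply (ψ : Sch n) (x y : Rn n) : shiftReflect ψ x y = ψ (x - y) := rfl

/-- rescaled kernel -/
def tlPhi (φ : ℕ → Sch n) (j : ℕ) : Sch n := dilate (φ j) ((2:ℝ) ^ j)

def tlK (φ : ℕ → Sch n) (j : ℕ) : Sch n := invFourierS (tlPhi φ j)

lemma tlPhi_apply (φ : ℕ → Sch n) (j : ℕ) (x : Rn n) :
    tlPhi φ j x = φ j ((2:ℝ) ^ j • x) := tl_dilate_apply _ (by positivity) _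

lemma tl_fourier_tlK (φ : ℕ → Sch n) (j : ℕ) : 𝓕 (fun x => tlK φ j x) = fun x => tlPhi φ j x := by
  have : 𝓕 (tlK φ j) = tlPhi φ j := (FourierTransform.fourierCLE ℂ (Sch n)).apply_symm_apply _
  have h2 := SchwartzMap.fourier_coe (tlK φ j)
  rw [this] at h2
  exact h2.symm

lemma tl_invFourierS_apply (ψ : Sch n) (x : Rn n) :
    invFourierS ψ x = ∫ ξ : Rn n, 𝐞 (inner ℝ ξ x) • ψ ξ := by
  have h2 := SchwartzMap.fourierInv_coe ψ
  have : invFourierS ψ x = 𝓕⁻ (ψ : Rn n → ℂ) x := by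
    rw [← h2]; rfl
  rw [this, Real.fourierInv_eq]

lemma tl_invFourierS_scale (φ : ℕ → Sch n) (j : ℕ) (x : Rn n) :
    invFourierS (φ j) x = (((2:ℝ) ^ j) ^ n) • tlK φ j ((2:ℝ) ^ j • x) := by
  have h2 : (0:ℝ) < ((2:ℝ)^j)^n := by positivity
  rw [tlK, tl_invFourierS_apply, tl_invFourierS_apply]
  have h := Measure.integral_comp_smul (volume : Measure (Rn n))
    (fun ξ : Rn n => 𝐞 (inner ℝ ξ x) • φ j ξ) ((2:ℝ)^j)
  have h3 : (∫ ξ : Rn n, 𝐞 (inner ℝ ξ ((2:ℝ) ^ j • x)) • tlPhi φ j ξ) =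
    ∫ ξ : Rn n, (fun ξ : Rn n => 𝐞 (inner ℝ ξ x) • φ j ξ) ((2:ℝ)^j • ξ) := by
    congr 1
    funext ξ
    simp only [tlPhi_apply, inner_smul_left, inner_smul_right]
    rfl
  rw [h3, h, smul_smul, finrank_euclideanSpace_fin, abs_of_pos (by positivity),
    mul_inv_cancel₀ h2.ne', one_smul]

lemma tl_phi_bound {φ : ℕ → Sch n} (hφ : SmoothResolution n φ) (l : ℕ) :
    ∃ C : ℝ, 0 ≤ C ∧ ∀ j ξ, ‖iteratedFDeriv ℝ l (tlPhi φ j) ξ‖ ≤ C := by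
  choose c hc using hφ.deriv_bound
  refine ⟨(n:ℝ)^l * ∑ α : Fin n → Fin (l+1), |c (fun i => α i)|, by positivity, fun j ξ => ?_⟩
  have hcd : ContDiff ℝ l (φ j) := (φ j).smooth l
  have h1 : iteratedFDeriv ℝ l (tlPhi φ j) = fun x => ((2:ℝ)^j) ^ l •
      iteratedFDeriv ℝ l (φ j) ((2:ℝ)^j • x) := by
    have : (tlPhi φ j : Rn n → ℂ) = fun x => φ j ((2:ℝ) ^ j • x) := funext (tlPhi_apply φ j)
    rw [this, iteratedFDeriv_comp_const_smul _ hcd]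
  set S := ∑ α : Fin n → Fin (l+1), |c (fun i => α i)| with hS
  have hS0 : 0 ≤ S := by positivity
  have h2 : ‖iteratedFDeriv ℝ l (φ j) ((2:ℝ)^j • ξ)‖ ≤ (n:ℝ)^l * (S * (2:ℝ) ^ (-(j:ℝ) * (l:ℝ))) := by
    apply tl_norm_iteratedFDeriv_le hcd (by positivity)
    intro α hα
    refine (hc α j _).trans ?_
    rw [hα]
    gcongr
    have hlt : ∀ i, α i < l + 1 := by
      intro i
      have : α i ≤ mdeg α := Finset.single_le_sum (f := α) (fun _ _ => Nat.zero_le _)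
        (Finset.mem_univ i)
      omega
    have := Finset.single_le_sum (f := fun α : Fin n → Fin (l+1) => |c (fun i => α i)|)
      (fun _ _ => abs_nonneg _) (Finset.mem_univ (fun i => ⟨α i, hlt i⟩))
    exact (le_abs_self _).trans this
  rw [h1]
  simp only
  rw [norm_smul]
  calc _ ≤ ‖((2:ℝ)^j) ^ l‖ * ((n:ℝ)^l * (S * (2:ℝ) ^ (-(j:ℝ) * (l:ℝ)))) := by gcongr
    _ = (n:ℝ)^l * S * (((2:ℝ)^j) ^ l * (2:ℝ) ^ (-(j:ℝ) * (l:ℝ))) := by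
      rw [Real.norm_of_nonneg (by positivity)]; ring
    _ = _ := by
      rw [neg_mul, Real.rpow_neg (by norm_num), ← pow_mul, ← Nat.cast_mul, Real.rpow_natCast,
        mul_inv_cancel₀ (by positivity), mul_one]

lemma tl_phi_supp {φ : ℕ → Sch n} (hφ : SmoothResolution n φ) (j : ℕ) :
    tsupport (tlPhi φ j) ⊆ closedBall 0 2 := by
  apply closure_minimal _ isClosed_closedBall
  intro ξ hξ
  have h1 : φ j ((2:ℝ)^j • ξ) ≠ 0 := by rwa [Function.mem_support, tlPhi_apply] at hξ
  have h2 : ‖(2:ℝ)^j • ξ‖ ≤ 2 ^ ((j:ℝ) + 1) := by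
    rcases Nat.eq_zero_or_pos j with rfl | hj
    · simpa using hφ.supp0 h1
    · exact (hφ.suppj j hj h1).2
  rw [norm_smul, Real.norm_of_nonneg (by positivity), Real.rpow_add (by norm_num),
    Real.rpow_natCast, Real.rpow_one] at h2
  simpa using le_of_mul_le_mul_left h2 (by positivity)

lemma tl_phi_seminorm {φ : ℕ → Sch n} (hφ : SmoothResolution n φ) (k l : ℕ) :
    ∃ C : ℝ, 0 ≤ C ∧ ∀ j, SchwartzMap.seminorm ℂ k l (tlPhi φ j) ≤ C := by
  obtain ⟨C, hC0, hC⟩ := tl_phi_bound hφ l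
  refine ⟨2 ^ k * C, by positivity, fun j => ?_⟩
  refine SchwartzMap.seminorm_le_bound ℂ k l _ (by positivity) fun x => ?_
  by_cases hx : iteratedFDeriv ℝ l (tlPhi φ j) x = 0
  · rw [hx]; simp; positivity
  · have h1 : x ∈ closedBall (0 : Rn n) 2 :=
      tl_phi_supp hφ j (support_iteratedFDeriv_subset l hx)
    have h2 : ‖x‖ ≤ 2 := by simpa using h1
    have := hC j x
    gcongr

lemma tl_finset_sup_bound {ι : Type*} (p : ι → ℕ × ℕ → ℝ)  (hp : ∀ a, ∃ C : ℝ, 0 ≤ C ∧ ∀ j, p j a ≤ C)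
    (s : Finset (ℕ × ℕ)) : ∃ C : ℝ, 0 ≤ C ∧ ∀ a ∈ s, ∀ j, p j a ≤ C := by
  choose c hc0 hc using hp
  refine ⟨∑ a ∈ s, c a, Finset.sum_nonneg fun a _ => hc0 a, fun a ha j => (hc a j).trans ?_⟩
  exact Finset.single_le_sum (fun a _ => hc0 a) ha

lemma tl_K_seminorm {φ : ℕ → Sch n} (hφ : SmoothResolution n φ) (k l : ℕ) :
    ∃ C : ℝ, 0 ≤ C ∧ ∀ j, SchwartzMap.seminorm ℂ k l (tlK φ j) ≤ C := by
  let T := (FourierTransform.fourierCLE ℂ (Sch n)).symm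
  let q : Seminorm ℂ (Sch n) := (SchwartzMap.seminorm ℂ k l).comp (T : Sch n →ₗ[ℂ] Sch n)
  have hq : Continuous q :=
    ((schwartz_withSeminorms ℂ (Rn n) ℂ).continuous_seminorm (k, l)).comp T.continuous
  obtain ⟨s, C, -, hC⟩ := Seminorm.bound_of_continuous (schwartz_withSeminorms ℂ (Rn n) ℂ) q hq
  obtain ⟨D, hD0, hD⟩ := tl_finset_sup_bound
    (fun j (a : ℕ × ℕ) => SchwartzMap.seminorm ℂ a.1 a.2 (tlPhi φ j))
    (fun a => tl_phi_seminorm hφ a.1 a.2) s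
  refine ⟨C * D, by positivity, fun j => ?_⟩
  have h1 := hC (tlPhi φ j)
  have h2 : (s.sup (schwartzSeminormFamily ℂ (Rn n) ℂ)) (tlPhi φ j) ≤ D :=
    Seminorm.finset_sup_apply_le hD0 fun a ha => hD a ha j
  calc _ = q (tlPhi φ j) := rfl
    _ ≤ C * (s.sup (schwartzSeminormFamily ℂ (Rn n) ℂ)) (tlPhi φ j) := h1
    _ ≤ _ := by gcongr

lemma tl_K_bound {φ : ℕ → Sch n} (hφ : SmoothResolution n φ) (k l : ℕ) :
    ∃ C : ℝ, 0 ≤ C ∧ ∀ j x, (1 + ‖x‖) ^ k * ‖iteratedFDeriv ℝ l (tlK φ j) x‖ ≤ C := by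
  obtain ⟨D, hD0, hD⟩ := tl_finset_sup_bound
    (fun j (a : ℕ × ℕ) => SchwartzMap.seminorm ℂ a.1 a.2 (tlK φ j))
    (fun a => tl_K_seminorm hφ a.1 a.2) (Finset.Iic (k, l))
  refine ⟨2 ^ k * D, by positivity, fun j x => ?_⟩
  refine (SchwartzMap.one_add_le_sup_seminorm_apply (𝕜 := ℂ) (m := (k, l)) (k := k) (n := l)
    le_rfl le_rfl (tlK φ j) x).trans ?_
  simp only
  gcongr
  exact Seminorm.finset_sup_apply_le hD0 fun a ha => hD a ha j

lemma tl_K_moment {φ : ℕ → Sch n} (hφ : SmoothResolution n φ) {j : ℕ} (hj : 0 < j) (l : ℕ)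
    (m : Fin l → Rn n) : ∫ v : Rn n, (∏ i, inner ℝ v (m i)) • tlK φ j v = 0 := by
  have hint : ∀ (k : ℕ), (k : ℕ∞) ≤ (l : ℕ∞) → Integrable (fun v : Rn n ↦ ‖v‖ ^ k * ‖tlK φ j v‖) :=
    fun k _ => (tlK φ j).integrable_pow_mul volume k
  have hmeas : AEStronglyMeasurable (fun x => tlK φ j x) (volume : Measure (Rn n)) :=
    (tlK φ j).continuous.aestronglyMeasurable
  have h1 := Real.iteratedFDeriv_fourier (N := (l : ℕ∞)) hint hmeas (n := l) le_rfl
  rw [tl_fourier_tlK] at h1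
  have h2 : (fun x => tlPhi φ j x) =ᶠ[𝓝 (0 : Rn n)] fun _ => 0 := by
    have : ball (0 : Rn n) (1/2) ∈ 𝓝 (0 : Rn n) := ball_mem_nhds _ (by norm_num)
    filter_upwards [this] with ξ hξ
    rw [tlPhi_apply]
    by_contra h
    have h3 := (hφ.suppj j hj h).1
    rw [norm_smul, Real.norm_of_nonneg (by positivity), Real.rpow_sub (by norm_num),
      Real.rpow_natCast, Real.rpow_one] at h3
    have h4 : ‖ξ‖ < 1/2 := by simpa using hξ
    have h5 : (0:ℝ) < 2 ^ j := by positivity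
    nlinarith
  have h3 : iteratedFDeriv ℝ l (fun x => tlPhi φ j x) (0 : Rn n) = 0 := by
    rw [(h2.iteratedFDeriv ℝ l).eq_of_nhds]
    simp
  have h4 := congrFun h1 0
  rw [h3] at h4
  have h5 := congrArg (fun T => T m) h4
  simp only [_root_.zero_apply] at h5
  rw [Real.fourier_continuousMultilinearMap_apply
    (VectorFourier.integrable_fourierPowSMulRight _ (hint l le_rfl) hmeas), Real.fourier_eq] at h5
  simp only [VectorFourier.fourierPowSMulRight_apply, inner_zero_right, neg_zero,
    AddChar.map_zero_eq_one, one_smul] at h5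
  rw [integral_smul] at h5
  have h6 := (smul_eq_zero.mp h5.symm).resolve_left (by
    apply pow_ne_zero
    simp [Real.pi_ne_zero])
  exact h6
end TLKernel

section TLHiLo
variable [CompleteSpace E]

lemma tl_prod_coord_le {l : ℕ} (v : Rn n) (r : ℝ) (c : Fin l → Fin n) :
    ‖∏ i, (r • v) (c i)‖ ≤ |r| ^ l * ‖v‖ ^ l := by
  rw [norm_prod, ← mul_pow]
  calc ∏ i, ‖(r • v) (c i)‖ ≤ ∏ _i : Fin l, (|r| * ‖v‖) := by
        refine Finset.prod_le_prod (fun _ _ => norm_nonneg _) fun i _ => ?_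
        refine (PiLp.norm_apply_le _ _).trans ?_
        rw [norm_smul, Real.norm_eq_abs]
    _ = _ := by simp

lemma tl_prod_coord_smul {l : ℕ} (v : Rn n) (r : ℝ) (c : Fin l → Fin n) :
    ∏ i, (r • v) (c i) = r ^ l * ∏ i, v (c i) := by
  simp [Finset.prod_mul_distrib]

lemma tl_int_prod {F : Type*} [NormedAddCommGroup F] [NormedSpace ℝ F] {h : Rn n → F}
    (hc : Continuous h) {l : ℕ}
    (hint : Integrable (fun v : Rn n ↦ ‖v‖ ^ l * ‖h v‖)) (r : ℝ) (c : Fin l → Fin n) :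
    Integrable (fun v : Rn n => (∏ i, (r • v) (c i)) • h v) := by
  refine Integrable.mono' (hint.const_mul (|r| ^ l)) ?_ (ae_of_all _ fun v => ?_)
  · apply Continuous.aestronglyMeasurable
    fun_prop
  · rw [norm_smul, ← mul_assoc]
    gcongr
    exact tl_prod_coord_le v r c

lemma tl_moment_hi {h : Rn n → ℂ} (hc : Continuous h) {l : ℕ}
    (hint : Integrable (fun v : Rn n ↦ ‖v‖ ^ l * ‖h v‖))
    (hm : ∀ c : Fin l → Fin n, ∫ v : Rn n, (∏ i, v (c i)) • h v = 0)
    (T : (Rn n) [×l]→L[ℝ] E) (r : ℝ) :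
    Integrable (fun v => h v • T (fun _ => r • v)) ∧ ∫ v : Rn n, h v • T (fun _ => r • v) = 0 := by
  have key : (fun v => h v • T (fun _ => r • v)) = fun v => ∑ c : Fin l → Fin n,
      ((∏ i, (r • v) (c i)) • h v) • T (fun i => EuclideanSpace.single (c i) (1:ℝ)) := by
    funext v
    rw [tl_multi_expand T, Finset.smul_sum]
    refine Finset.sum_congr rfl fun c _ => ?_
    rw [smul_comm, smul_assoc]
  have hi : ∀ c : Fin l → Fin n, Integrable (fun v : Rn n => ((∏ i, (r • v) (c i)) • h v) •
      T (fun i => EuclideanSpace.single (c i) (1:ℝ))) := fun c =>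
    (tl_int_prod hc hint r c).smul_const _
  rw [key]
  refine ⟨integrable_finsetSum _ fun c _ => hi c, ?_⟩
  rw [integral_finsetSum _ fun c _ => hi c]
  refine Finset.sum_eq_zero fun c _ => ?_
  rw [integral_smul_const]
  simp_rw [tl_prod_coord_smul, mul_smul]
  rw [integral_smul, hm c, smul_zero, zero_smul]

lemma tl_moment_lo {h : Rn n → E} (hc : Continuous h) {l : ℕ}
    (hint : Integrable (fun v : Rn n ↦ ‖v‖ ^ l * ‖h v‖))
    (hm : ∀ c : Fin l → Fin n, ∫ v : Rn n, (∏ i, v (c i)) • h v = 0)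
    (T : (Rn n) [×l]→L[ℝ] ℂ) (r : ℝ) :
    Integrable (fun v => T (fun _ => r • v) • h v) ∧ ∫ v : Rn n, T (fun _ => r • v) • h v = 0 := by
  have key : (fun v => T (fun _ => r • v) • h v) = fun v => ∑ c : Fin l → Fin n,
      T (fun i => EuclideanSpace.single (c i) (1:ℝ)) • ((∏ i, (r • v) (c i)) • h v) := by
    funext v
    rw [tl_multi_expand T, Finset.sum_smul]
    refine Finset.sum_congr rfl fun c _ => ?_
    rw [smul_comm, smul_assoc]
  have hi : ∀ c : Fin l → Fin n, Integrable (fun v : Rn n =>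
      T (fun i => EuclideanSpace.single (c i) (1:ℝ)) • ((∏ i, (r • v) (c i)) • h v)) := fun c =>
    (tl_int_prod hc hint r c).smul _
  rw [key]
  refine ⟨integrable_finsetSum _ fun c _ => hi c, ?_⟩
  rw [integral_finsetSum _ fun c _ => hi c]
  refine Finset.sum_eq_zero fun c _ => ?_
  rw [integral_smul]
  simp_rw [tl_prod_coord_smul, mul_smul]
  rw [integral_smul, hm c, smul_zero, smul_zero]

def tlI (n : ℕ) : ℝ := ∫ y : Rn n, (1 + ‖y‖) ^ (-((n:ℝ) + 1))

lemma tlI_integrable (n : ℕ) : Integrable (fun y : Rn n => (1 + ‖y‖) ^ (-((n:ℝ) + 1))) :=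
  integrable_one_add_norm (by simp)

lemma tl_hi {κ : Sch n} {k M : ℕ} {C : ℝ}
    (hκ : ∀ x, (1 + ‖x‖) ^ (k + M + (n + 1)) * ‖κ x‖ ≤ C)
    (hm : ∀ l < k, ∀ c : Fin l → Fin n, ∫ v : Rn n, (∏ i, v (c i)) • κ v = 0)
    {A : Rn n → E} (hA : ContDiff ℝ k A) {R : ℝ} (hR : 0 ≤ R)
    (hsupp : Function.support A ⊆ closedBall 0 R) {B : ℝ}
    (hB : ∀ x, ‖iteratedFDeriv ℝ k A x‖ ≤ B) {t : ℝ} (ht : 1 ≤ t) (X : Rn n) :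
    ‖∫ y, κ y • A (X - t⁻¹ • y)‖ ≤
      ((2 * (1 + 2 * R)) ^ M * tlI n) * C * B * t⁻¹ ^ k * ((1 + ‖X‖) ^ M)⁻¹ := by
  have ht0 : 0 < t := by linarith
  have hB0 : 0 ≤ B := (norm_nonneg _).trans (hB 0)
  have hC0 : 0 ≤ C := le_trans (by positivity) (hκ 0)
  have hts : tsupport A ⊆ closedBall 0 R := closure_minimal hsupp isClosed_closedBall
  let P : Rn n → E := fun y => ∑ l ∈ Finset.range k, ((Nat.factorial l : ℝ))⁻¹ •
      iteratedFDeriv ℝ l A X (fun _ => (-t⁻¹) • y)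
  have hmom : ∀ l ∈ Finset.range k,
      Integrable (fun v => κ v • ((Nat.factorial l : ℝ))⁻¹ •
        iteratedFDeriv ℝ l A X (fun _ => (-t⁻¹) • v)) ∧
      ∫ v, κ v • ((Nat.factorial l : ℝ))⁻¹ • iteratedFDeriv ℝ l A X (fun _ => (-t⁻¹) • v) = 0 := by
    intro l hl
    have := tl_moment_hi κ.continuous (κ.integrable_pow_mul volume l) (hm l (Finset.mem_range.mp hl))
      (iteratedFDeriv ℝ l A X) (-t⁻¹)
    simp_rw [smul_comm (_ : ℂ) ((Nat.factorial l : ℝ))⁻¹]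
    refine ⟨this.1.smul _, ?_⟩
    rw [integral_smul, this.2, smul_zero]
  have hPint : Integrable (fun y => κ y • P y) := by
    simp only [P, Finset.smul_sum]
    exact integrable_finsetSum _ fun l hl => (hmom l hl).1
  have hP0 : ∫ y, κ y • P y = 0 := by
    simp only [P, Finset.smul_sum]
    rw [integral_finsetSum _ fun l hl => (hmom l hl).1]
    exact Finset.sum_eq_zero fun l hl => (hmom l hl).2
  have hrem : ∀ y, ‖A (X - t⁻¹ • y) - P y‖ ≤ B * t⁻¹ ^ k * ‖y‖ ^ k := by
    intro y
    have := tl_taylor hA X ((-t⁻¹) • y) (B := B) (fun θ _ => hB _)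
    rw [norm_smul, norm_neg, Real.norm_of_nonneg (by positivity), mul_pow, ← mul_assoc] at this
    convert this using 3
    rw [neg_smul, sub_eq_add_neg]
  have hpt : ∀ y, ‖κ y • A (X - t⁻¹ • y) - κ y • P y‖ ≤
      ((2 * (1 + 2 * R)) ^ M * C * B * t⁻¹ ^ k * ((1 + ‖X‖) ^ M)⁻¹) *
        (1 + ‖y‖) ^ (-((n:ℝ) + 1)) := by
    intro y
    rw [← smul_sub, norm_smul]
    have hdec : ‖κ y‖ * (1 + ‖y‖) ^ (k + M) ≤ C * (1 + ‖y‖) ^ (-((n:ℝ) + 1)) := by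
      have h1 : (1 + ‖y‖) ^ (-((n:ℝ) + 1)) = ((1 + ‖y‖) ^ (n+1))⁻¹ := by
        rw [Real.rpow_neg (by positivity)]
        congr 1
        exact_mod_cast Real.rpow_natCast (1 + ‖y‖) (n+1)
      rw [h1, ← div_eq_mul_inv, le_div_iff₀ (by positivity)]
      calc _ = (1 + ‖y‖) ^ (k + M + (n + 1)) * ‖κ y‖ := by rw [pow_add _ (k+M)]; ring
        _ ≤ C := hκ y
    have hX : ‖A (X - t⁻¹ • y) - P y‖ * (1 + ‖X‖)^M ≤
        B * t⁻¹ ^ k * ‖y‖ ^ k * ((2 * (1 + 2 * R)) * (1 + ‖y‖)) ^ M := by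
      by_cases h0 : A (X - t⁻¹ • y) - P y = 0
      · rw [h0]; simp only [norm_zero, zero_mul]; positivity
      have hle : 1 + ‖X‖ ≤ (2 * (1 + 2 * R)) * (1 + ‖y‖) := by
        have hy := norm_nonneg y
        by_cases hXR : ‖X‖ ≤ 2 * R
        · nlinarith [mul_nonneg hR hy]
        push Not at hXR
        have hX1 : X ∉ closedBall (0 : Rn n) R := by simp; linarith
        have hPz : P y = 0 := by
          refine Finset.sum_eq_zero fun l _ => ?_
          have : iteratedFDeriv ℝ l A X = 0 := by
            by_contra hne
            exact hX1 (hts (support_iteratedFDeriv_subset l hne))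
          rw [this]; simp
        rw [hPz, sub_zero] at h0
        have h3 : ‖X - t⁻¹ • y‖ ≤ R := by simpa using hsupp h0
        have h4 : ‖t⁻¹ • y‖ ≤ ‖y‖ := by
          rw [norm_smul, Real.norm_of_nonneg (by positivity)]
          exact mul_le_of_le_one_left hy (inv_le_one_of_one_le₀ ht)
        have h5 : ‖X‖ ≤ ‖X - t⁻¹ • y‖ + ‖t⁻¹ • y‖ := by
          simpa using norm_add_le (X - t⁻¹ • y) (t⁻¹ • y)
        nlinarith [mul_nonneg hR hy]
      have := hrem y
      gcongr
    have hXpos : 0 < (1 + ‖X‖)^M := by positivity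
    have hX' : ‖A (X - t⁻¹ • y) - P y‖ ≤
        B * t⁻¹ ^ k * ‖y‖ ^ k * ((2 * (1 + 2 * R)) * (1 + ‖y‖)) ^ M * ((1 + ‖X‖)^M)⁻¹ := by
      rw [← div_eq_mul_inv, le_div_iff₀ hXpos]; exact hX
    calc ‖κ y‖ * ‖A (X - t⁻¹ • y) - P y‖ ≤ ‖κ y‖ * (B * t⁻¹ ^ k * (1 + ‖y‖) ^ k *
          ((2 * (1 + 2 * R)) * (1 + ‖y‖)) ^ M * ((1 + ‖X‖)^M)⁻¹) := by
          refine mul_le_mul_of_nonneg_left (hX'.trans ?_) (norm_nonneg _)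
          gcongr
          linarith
      _ = (‖κ y‖ * (1 + ‖y‖) ^ (k + M)) *
          ((2 * (1 + 2 * R)) ^ M * B * t⁻¹ ^ k * ((1 + ‖X‖) ^ M)⁻¹) := by
          rw [mul_pow, pow_add]; ring
      _ ≤ (C * (1 + ‖y‖) ^ (-((n:ℝ) + 1))) *
          ((2 * (1 + 2 * R)) ^ M * B * t⁻¹ ^ k * ((1 + ‖X‖) ^ M)⁻¹) := by gcongr
      _ = _ := by ring
  have hmeas : AEStronglyMeasurable (fun y => κ y • A (X - t⁻¹ • y)) (volume : Measure (Rn n)) := by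
    apply Continuous.aestronglyMeasurable
    have := hA.continuous
    have := κ.continuous
    fun_prop
  have hdint : Integrable (fun y => κ y • A (X - t⁻¹ • y) - κ y • P y) :=
    Integrable.mono' ((tlI_integrable n).const_mul _) (hmeas.sub hPint.1) (ae_of_all _ hpt)
  have hAint : Integrable (fun y => κ y • A (X - t⁻¹ • y)) := by
    refine (hdint.add hPint).congr (ae_of_all _ fun y => ?_)
    simp
  have : ∫ y, κ y • A (X - t⁻¹ • y) = ∫ y, (κ y • A (X - t⁻¹ • y) - κ y • P y) := by
    rw [integral_sub hAint hPint, hP0, sub_zero]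
  rw [this]
  refine (norm_integral_le_of_norm_le ((tlI_integrable n).const_mul _) (ae_of_all _ hpt)).trans ?_
  rw [integral_const_mul]
  apply le_of_eq
  unfold tlI
  ring

lemma tl_lo {κ : Sch n} {k M : ℕ} {C : ℝ}
    (hκ : ∀ x, (1 + ‖x‖) ^ M * ‖iteratedFDeriv ℝ k κ x‖ ≤ C)
    {A : Rn n → E} (hA : Continuous A)
    (hm : ∀ l < k, ∀ c : Fin l → Fin n, ∫ v : Rn n, (∏ i, v (c i)) • A v = 0)
    {R : ℝ} (hR : 0 ≤ R)
    (hsupp : Function.support A ⊆ closedBall 0 R) {B : ℝ}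
    (hB : ∀ x, ‖A x‖ ≤ B) {t : ℝ} (ht : 0 < t) (ht1 : t ≤ 1) (X : Rn n) :
    ‖∫ z, κ (t • X - t • z) • A z‖ ≤
      ((1 + R) ^ M * R ^ k * volume.real (closedBall (0 : Rn n) R)) * C * B * t ^ k *
        ((1 + t * ‖X‖) ^ M)⁻¹ := by
  have hB0 : 0 ≤ B := (norm_nonneg _).trans (hB 0)
  have hC0 : 0 ≤ C := le_trans (by positivity) (hκ 0)
  have hts : tsupport A ⊆ closedBall 0 R := closure_minimal hsupp isClosed_closedBall
  have hcs : HasCompactSupport A := (isCompact_closedBall (0 : Rn n) R).of_isClosed_subset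
    (isClosed_tsupport A) hts
  have hint : ∀ l : ℕ, Integrable (fun v : Rn n => ‖v‖ ^ l * ‖A v‖) := by
    intro l
    apply Continuous.integrable_of_hasCompactSupport (by fun_prop)
    exact hcs.norm.mul_left
  let P : Rn n → ℂ := fun z => ∑ l ∈ Finset.range k, ((Nat.factorial l : ℝ))⁻¹ •
      iteratedFDeriv ℝ l κ (t • X) (fun _ => (-t) • z)
  have hmom : ∀ l ∈ Finset.range k,
      Integrable (fun v => (((Nat.factorial l : ℝ))⁻¹ •
        iteratedFDeriv ℝ l κ (t • X) (fun _ => (-t) • v)) • A v) ∧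
      ∫ v, (((Nat.factorial l : ℝ))⁻¹ • iteratedFDeriv ℝ l κ (t • X) (fun _ => (-t) • v)) • A v
        = 0 := by
    intro l hl
    have := tl_moment_lo hA (hint l) (hm l (Finset.mem_range.mp hl))
      (iteratedFDeriv ℝ l κ (t • X)) (-t)
    simp_rw [smul_assoc]
    refine ⟨this.1.smul _, ?_⟩
    rw [integral_smul, this.2, smul_zero]
  have hPint : Integrable (fun z => P z • A z) := by
    simp only [P, Finset.sum_smul]
    exact integrable_finsetSum _ fun l hl => (hmom l hl).1
  have hP0 : ∫ z, P z • A z = 0 := by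
    simp only [P, Finset.sum_smul]
    rw [integral_finsetSum _ fun l hl => (hmom l hl).1]
    exact Finset.sum_eq_zero fun l hl => (hmom l hl).2
  have hAint : Integrable (fun z => κ (t • X - t • z) • A z) := by
    apply Continuous.integrable_of_hasCompactSupport
    · have := κ.continuous
      fun_prop
    · exact hcs.smul_left
  have : ∫ z, κ (t • X - t • z) • A z = ∫ z, (κ (t • X - t • z) - P z) • A z := by
    simp_rw [sub_smul]
    rw [integral_sub hAint hPint, hP0, sub_zero]
  rw [this, ← setIntegral_eq_integral_of_forall_compl_eq_zero (s := closedBall (0 : Rn n) R)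
    (fun z hz => by
      have : A z = 0 := by
        by_contra h
        exact hz (hsupp h)
      rw [this, smul_zero])]
  have hpt : ∀ z ∈ closedBall (0 : Rn n) R, ‖(κ (t • X - t • z) - P z) • A z‖ ≤
      (1 + R) ^ M * R ^ k * C * B * t ^ k * ((1 + t * ‖X‖) ^ M)⁻¹ := by
    intro z hz
    have hz' : ‖z‖ ≤ R := by simpa using hz
    have h1 := tl_taylor (g := κ) (k := k) (κ.smooth k) (t • X) ((-t) • z)
      (B := (1 + R) ^ M * C * ((1 + t * ‖X‖) ^ M)⁻¹) (by
        intro θ hθ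
        set x := t • X + θ • (-t) • z with hx
        have h2 : 1 + t * ‖X‖ ≤ (1 + R) * (1 + ‖x‖) := by
          have h3 : t • X = x + θ • t • z := by rw [hx]; module
          have h4 : ‖t • X‖ ≤ ‖x‖ + ‖θ • t • z‖ := by rw [h3]; exact norm_add_le _ _
          rw [norm_smul, norm_smul, norm_smul, Real.norm_of_nonneg ht.le,
            Real.norm_of_nonneg hθ.1] at h4
          have h5 : t * ‖z‖ ≤ 1 * R := by gcongr
          have h6 : θ * (t * ‖z‖) ≤ 1 * (1 * R) := by
            apply mul_le_mul hθ.2 h5 (by positivity) (by norm_num)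
          nlinarith [norm_nonneg x]
        have h7 : ‖iteratedFDeriv ℝ k κ x‖ ≤ C * ((1 + ‖x‖)^M)⁻¹ := by
          rw [← div_eq_mul_inv, le_div_iff₀ (by positivity), mul_comm]
          exact hκ x
        refine h7.trans ?_
        rw [mul_comm ((1+R)^M) C, mul_assoc]
        refine mul_le_mul_of_nonneg_left ?_ hC0
        rw [← div_eq_mul_inv, le_div_iff₀ (by positivity), ← div_eq_inv_mul,
          div_le_iff₀ (by positivity), ← mul_pow]
        gcongr)
    rw [norm_smul]
    have h8 : ‖κ (t • X - t • z) - P z‖ ≤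
        (1 + R) ^ M * C * ((1 + t * ‖X‖) ^ M)⁻¹ * (t * R) ^ k := by
      have h9 : t • X - t • z = t • X + (-t) • z := by module
      rw [h9]
      refine h1.trans ?_
      rw [norm_smul, norm_neg, Real.norm_of_nonneg ht.le]
      gcongr
    calc _ ≤ ((1 + R) ^ M * C * ((1 + t * ‖X‖) ^ M)⁻¹ * (t * R) ^ k) * B := by
          have := hB z
          gcongr
      _ = _ := by rw [mul_pow]; ring
  refine (norm_setIntegral_le_of_norm_le_const measure_closedBall_lt_top hpt).trans ?_
  apply le_of_eq
  ring
end TLHiLo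

section TLAtom
variable [CompleteSpace E]

lemma tl_norm_le_sum (z : Rn n) : ‖z‖ ≤ ∑ i, |z i| := by
  have : z = ∑ i : Fin n, z i • EuclideanSpace.single i (1:ℝ) := by
    ext c
    simp [Finset.sum_apply, Pi.single_apply]
  conv_lhs => rw [this]
  refine (norm_sum_le _ _).trans (Finset.sum_le_sum fun i _ => ?_)
  rw [norm_smul]
  simp

def tlA (ν : ℕ) (m : Fin n → ℤ) (a : Rn n → E) : Rn n → E :=
  fun z => a (((2:ℝ)^ν)⁻¹ • (z + zpt m))

lemma tlA_contDiff {ν : ℕ} {m : Fin n → ℤ} {a : Rn n → E} {k : ℕ} (h : ContDiff ℝ k a) :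
    ContDiff ℝ k (tlA ν m a) := by
  unfold tlA
  fun_prop

lemma tlA_supp {ν : ℕ} {m : Fin n → ℤ} {a : Rn n → E} {d : ℝ} (hd : 1 < d)
    (h : Function.support a ⊆ dQ d ν m) :
    Function.support (tlA ν m a) ⊆ closedBall 0 (n * d) := by
  intro z hz
  have h1 := h (show a _ ≠ 0 from hz)
  simp only [dQ, Set.mem_ofPred_eq] at h1
  have h2 : ∀ i, |z i| ≤ d := by
    intro i
    have h3 := h1 i
    rw [Real.rpow_neg (by norm_num), Real.rpow_natCast] at h3
    have hp : (0:ℝ) < ((2:ℝ)^ν)⁻¹ := by positivity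
    have h4 : (((2:ℝ)^ν)⁻¹ • (z + zpt m)) i - ((2:ℝ)^ν)⁻¹ * (m i : ℝ) = ((2:ℝ)^ν)⁻¹ * z i := by
      simp [zpt]
    rw [h4, abs_mul, abs_of_pos hp] at h3
    have h5 : ((2:ℝ)^ν)⁻¹ * |z i| ≤ ((2:ℝ)^ν)⁻¹ * (d / 2) := by linarith
    have := le_of_mul_le_mul_left h5 hp
    linarith
  simp only [mem_closedBall, dist_zero_right]
  refine (tl_norm_le_sum z).trans ?_
  refine (Finset.sum_le_sum fun i _ => h2 i).trans ?_
  simp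

lemma tlA_deriv {ν : ℕ} {m : Fin n → ℤ} {a : Rn n → E} {k : ℕ} (h : ContDiff ℝ k a) {b : ℝ}
    (hb : 0 ≤ b)
    (hder : ∀ α : Fin n → ℕ, mdeg α = k → ∀ x, ‖mderiv α a x‖ ≤ b * (2:ℝ) ^ (ν * k)) (z : Rn n) :
    ‖iteratedFDeriv ℝ k (tlA ν m a) z‖ ≤ (n:ℝ)^k * b := by
  set r := ((2:ℝ)^ν)⁻¹ with hr
  have h1 : tlA ν m a = fun z => (fun w => a (w + r • zpt m)) (r • z) := by
    funext z
    simp only [tlA, smul_add]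
    rfl
  have h2 : ContDiff ℝ k (fun w => a (w + r • zpt m)) := by fun_prop
  rw [h1, iteratedFDeriv_comp_const_smul r h2]
  simp only
  rw [iteratedFDeriv_comp_add_right, norm_smul]
  have h3 := tl_norm_iteratedFDeriv_le (x := r • z + r • zpt m) h (by positivity)
    (fun α hα => hder α hα _)
  have hrn : ‖r ^ k‖ = ((2:ℝ)^(ν*k))⁻¹ := by
    rw [Real.norm_of_nonneg (by positivity), hr, inv_pow, pow_mul]
  rw [hrn]
  calc _ ≤ ((2:ℝ)^(ν*k))⁻¹ * ((n:ℝ)^k * (b * (2:ℝ)^(ν*k))) := by gcongr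
    _ = _ := by field_simp

lemma tl_change {ν : ℕ} (m : Fin n → ℤ) (G : Rn n → E) :
    ∫ z : Rn n, G (((2:ℝ)^ν)⁻¹ • (z + zpt m)) = (((2:ℝ)^ν)^n) • ∫ y, G y := by
  rw [integral_add_right_eq_self (fun z => G (((2:ℝ)^ν)⁻¹ • z)) (zpt m),
    Measure.integral_comp_smul, finrank_euclideanSpace_fin, abs_of_pos (by positivity)]
  congr 1
  simp

lemma tl_poly_moment {a : Rn n → E} (ha : Continuous a) (hcs : HasCompactSupport a) {k : ℕ}
    (hm : ∀ β : Fin n → ℕ, mdeg β < k → ∫ x : Rn n, (∏ i, (x i) ^ (β i)) • a x = 0)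
    (P : MvPolynomial (Fin n) ℝ) (hP : P.totalDegree < k) :
    ∫ x : Rn n, (MvPolynomial.eval (fun i => x i) P) • a x = 0 := by
  have hint : ∀ β : Fin n → ℕ, Integrable (fun x : Rn n => (∏ i, (x i) ^ (β i)) • a x) := by
    intro β
    apply Continuous.integrable_of_hasCompactSupport (by fun_prop)
    exact hcs.smul_left
  simp_rw [MvPolynomial.eval_eq', Finset.sum_smul, mul_smul]
  have hi : ∀ β ∈ P.support, Integrable (fun x : Rn n => P.coeff β • (∏ i, x i ^ β i) • a x) :=
    fun β _ => (hint β).smul (P.coeff β)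
  rw [integral_finsetSum _ hi]
  refine Finset.sum_eq_zero fun β hβ => ?_
  rw [integral_smul, hm β, smul_zero]
  have h1 := MvPolynomial.le_totalDegree hβ
  rw [Finsupp.sum_fintype _ _ (by simp)] at h1
  exact lt_of_le_of_lt h1 hP

lemma tlA_moment {ν : ℕ} {m : Fin n → ℤ} {a : Rn n → E} (ha : Continuous a)
    (hcs : HasCompactSupport a) {k : ℕ}
    (hm : ∀ β : Fin n → ℕ, mdeg β < k → ∫ x : Rn n, (∏ i, (x i) ^ (β i)) • a x = 0)
    (l : ℕ) (hl : l < k) (c : Fin l → Fin n) :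
    ∫ z : Rn n, (∏ i, z (c i)) • tlA ν m a z = 0 := by
  let P : MvPolynomial (Fin n) ℝ := ∏ i, (MvPolynomial.C ((2:ℝ)^ν) * MvPolynomial.X (c i) -
    MvPolynomial.C (m (c i) : ℝ))
  have hP : P.totalDegree < k := by
    refine lt_of_le_of_lt ?_ hl
    refine (MvPolynomial.totalDegree_finsetProd _ _).trans ?_
    refine (Finset.sum_le_sum (g := fun _ => 1) fun i _ => ?_).trans (by simp)
    refine (MvPolynomial.totalDegree_sub _ _).trans ?_
    simp only [MvPolynomial.totalDegree_C, zero_le, sup_of_le_left]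
    refine (MvPolynomial.totalDegree_mul _ _).trans ?_
    rw [MvPolynomial.totalDegree_C, MvPolynomial.totalDegree_X]
  have h1 := tl_poly_moment ha hcs hm P hP
  have h2 := tl_change (ν := ν) m (fun y => (MvPolynomial.eval (fun i => y i) P) • a y)
  rw [h1, smul_zero] at h2
  rw [← h2]
  congr 1
  funext z
  simp only [P, tlA]
  congr 1
  rw [map_prod]
  refine Finset.prod_congr rfl fun i _ => ?_
  simp [zpt]
  field_simp
  ring

lemma tl_conv_lo (φ : ℕ → Sch n) (j ν : ℕ) (m : Fin n → ℤ) (a : Rn n → E) (x : Rn n) :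
    ∫ y, shiftReflect (invFourierS (φ j)) x y • a y = (((2:ℝ)^j * ((2:ℝ)^ν)⁻¹) ^ n) •
      ∫ z, tlK φ j (((2:ℝ)^j * ((2:ℝ)^ν)⁻¹) • ((2:ℝ)^ν • x - zpt m) -
        ((2:ℝ)^j * ((2:ℝ)^ν)⁻¹) • z) • tlA ν m a z := by
  have h2 := tl_change (ν := ν) m (fun y => tlK φ j ((2:ℝ)^j • (x - y)) • a y)
  have h3 : ∀ z, tlK φ j (((2:ℝ)^j * ((2:ℝ)^ν)⁻¹) • ((2:ℝ)^ν • x - zpt m) -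
        ((2:ℝ)^j * ((2:ℝ)^ν)⁻¹) • z) • tlA ν m a z =
      tlK φ j ((2:ℝ)^j • (x - ((2:ℝ)^ν)⁻¹ • (z + zpt m))) • a (((2:ℝ)^ν)⁻¹ • (z + zpt m)) := by
    intro z
    rw [tlA]
    congr 2
    have h4 : (2:ℝ)^ν ≠ 0 := by positivity
    match_scalars <;> field_simp
  simp_rw [h3]
  rw [h2, smul_smul, mul_pow, inv_pow, mul_assoc, inv_mul_cancel₀ (by positivity), mul_one,
    ← integral_smul]
  congr 1
  funext y
  rw [tl_shiftReflect_apply, tl_invFourierS_scale, smul_assoc]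

lemma tl_conv_hi (φ : ℕ → Sch n) (j ν : ℕ) (m : Fin n → ℤ) (a : Rn n → E) (x : Rn n) :
    ∫ y, shiftReflect (invFourierS (φ j)) x y • a y =
      ∫ y, tlK φ j y • tlA ν m a (((2:ℝ)^ν • x - zpt m) - ((2:ℝ)^j * ((2:ℝ)^ν)⁻¹)⁻¹ • y) := by
  rw [tl_conv_lo φ j ν m a x]
  set t := (2:ℝ)^j * ((2:ℝ)^ν)⁻¹ with ht
  have ht0 : 0 < t := by positivity
  set X := (2:ℝ)^ν • x - zpt m
  have h1 := Measure.integral_comp_smul (volume : Measure (Rn n))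
    (fun y => tlK φ j y • tlA ν m a (X - t⁻¹ • y)) t
  have h2 := integral_sub_left_eq_self (fun z => tlK φ j (t • z) • tlA ν m a (X - z))
    (volume : Measure (Rn n)) X
  simp only [sub_sub_cancel] at h2
  simp_rw [smul_smul, inv_mul_cancel₀ ht0.ne', one_smul] at h1
  simp_rw [← smul_sub]
  rw [h2, h1, smul_smul, finrank_euclideanSpace_fin, abs_of_pos (by positivity),
    mul_inv_cancel₀ (by positivity), one_smul]

lemma tl_atom_hi {φ : ℕ → Sch n} (hφ : SmoothResolution n φ) (K M : ℕ) {d : ℝ} (hd : 1 < d) :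
    ∃ C : ℝ, 0 ≤ C ∧ ∀ (j ν : ℕ) (_ : ν ≤ j) (_ : 0 < j ∨ K = 0) (m : Fin n → ℤ) (a : Rn n → E)
      (b : ℝ) (_ : 0 ≤ b) (_ : ContDiff ℝ K a) (_ : Function.support a ⊆ dQ d ν m)
      (_ : ∀ α : Fin n → ℕ, mdeg α = K → ∀ x, ‖mderiv α a x‖ ≤ b * (2:ℝ) ^ (ν * K)) (x : Rn n),
      ‖∫ y, shiftReflect (invFourierS (φ j)) x y • a y‖ ≤
        C * b * ((2:ℝ)^j * ((2:ℝ)^ν)⁻¹)⁻¹ ^ K * ((1 + ‖(2:ℝ)^ν • x - zpt m‖) ^ M)⁻¹ := by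
  obtain ⟨C, hC0, hC⟩ := tl_K_bound hφ (K + M + (n + 1)) 0
  have hI : 0 ≤ tlI n := integral_nonneg fun y => by positivity
  have hR : 0 ≤ (n:ℝ) * d := by positivity
  refine ⟨(2 * (1 + 2 * (n * d))) ^ M * tlI n * C * (n:ℝ)^K, by positivity, ?_⟩
  intro j ν hνj hj m a b hb hcd hsupp hder x
  rw [tl_conv_hi φ j ν m a x]
  have ht : 1 ≤ (2:ℝ)^j * ((2:ℝ)^ν)⁻¹ := by
    rw [← div_eq_mul_inv, one_le_div (by positivity)]
    exact pow_le_pow_right₀ (by norm_num) hνj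
  have h := tl_hi (κ := tlK φ j) (k := K) (M := M) (C := C) (fun x => by simpa using hC j x) (by
      intro l hl c
      have hj' : 0 < j := by omega
      have := tl_K_moment hφ hj' l (fun i => EuclideanSpace.single (c i) (1:ℝ))
      simpa [EuclideanSpace.inner_single_right] using this)
    (tlA_contDiff (ν := ν) (m := m) hcd) hR (tlA_supp hd hsupp) (tlA_deriv hcd hb hder) ht
    ((2:ℝ)^ν • x - zpt m)
  refine h.trans (le_of_eq ?_)
  ring

lemma tl_atom_lo {φ : ℕ → Sch n} (hφ : SmoothResolution n φ) (k M : ℕ) {d : ℝ} (hd : 1 < d) :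
    ∃ C : ℝ, 0 ≤ C ∧ ∀ (j ν : ℕ) (_ : j ≤ ν) (m : Fin n → ℤ) (a : Rn n → E)
      (b : ℝ) (_ : Continuous a) (_ : Function.support a ⊆ dQ d ν m)
      (_ : ∀ x, ‖a x‖ ≤ b)
      (_ : ∀ β : Fin n → ℕ, mdeg β < k → ∫ x : Rn n, (∏ i, (x i) ^ (β i)) • a x = 0) (x : Rn n),
      ‖∫ y, shiftReflect (invFourierS (φ j)) x y • a y‖ ≤
        C * b * ((2:ℝ)^j * ((2:ℝ)^ν)⁻¹) ^ (n + k) *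
          ((1 + ((2:ℝ)^j * ((2:ℝ)^ν)⁻¹) * ‖(2:ℝ)^ν • x - zpt m‖) ^ M)⁻¹ := by
  obtain ⟨C, hC0, hC⟩ := tl_K_bound hφ M k
  have hR : 0 ≤ (n:ℝ) * d := by positivity
  refine ⟨((1 + n * d) ^ M * (n * d) ^ k * volume.real (closedBall (0 : Rn n) (n * d))) * C,
    by positivity, ?_⟩
  intro j ν hνj m a b hcont hsupp hbd hmom x
  rw [tl_conv_lo φ j ν m a x]
  set t := (2:ℝ)^j * ((2:ℝ)^ν)⁻¹ with ht
  have ht0 : 0 < t := by positivity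
  have ht1 : t ≤ 1 := by
    rw [ht, ← div_eq_mul_inv, div_le_one (by positivity)]
    exact pow_le_pow_right₀ (by norm_num) hνj
  have hcs : HasCompactSupport a := by
    have hc : HasCompactSupport (tlA ν m a) := (isCompact_closedBall (0 : Rn n) (n * d)).of_isClosed_subset
      (isClosed_tsupport _) (closure_minimal (tlA_supp hd hsupp) isClosed_closedBall)
    have : a = tlA ν m a ∘ (fun y => (2:ℝ)^ν • y + (- zpt m)) := by
      funext y
      simp [tlA, smul_smul]
    rw [this]
    apply hc.comp_homeomorph (((Homeomorph.smulOfNeZero ((2:ℝ)^ν) (by positivity))).trans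
      (Homeomorph.addRight (- zpt m)))
  have h := tl_lo (κ := tlK φ j) (k := k) (M := M) (C := C) (fun x => hC j x)
    (A := tlA ν m a) (by unfold tlA; fun_prop)
    (tlA_moment hcont hcs hmom) hR (tlA_supp hd hsupp) (fun z => hbd _) ht0 ht1
    ((2:ℝ)^ν • x - zpt m)
  rw [norm_smul, Real.norm_of_nonneg (by positivity), pow_add]
  calc _ ≤ t ^ n * _ := mul_le_mul_of_nonneg_left h (by positivity)
    _ = _ := by ring
end TLAtom

section TLAtomEst
variable [CompleteSpace E]

lemma tl_pow_rpow_le {M : ℝ} {M0 : ℕ} (hM : M ≤ M0) {y : ℝ} (hy : 1 ≤ y) : (y ^ M0)⁻¹ ≤ y ^ (-M) := by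
  rw [← Real.rpow_natCast, ← Real.rpow_neg (by linarith)]
  exact Real.rpow_le_rpow_of_exponent_le hy (by linarith)

lemma tl_unify {s : ℝ} {p : ℝ≥0∞} {K : ℕ} {L : ℤ} {d : ℝ} (ν : ℕ) (m : Fin n → ℤ) (a : Rn n → E)
    (h0 : ν = 0 → Is1Atom K d m a) (h1 : 0 < ν → IsSPAtom s p K L d ν m a) :
    ContDiff ℝ K a ∧ Function.support a ⊆ dQ d ν m ∧
    (∀ α : Fin n → ℕ, mdeg α ≤ K → ∀ x, ‖mderiv α a x‖ ≤
      (2:ℝ) ^ (-(ν : ℝ) * (s - (n : ℝ) / p.toReal)) * (2:ℝ) ^ (ν * mdeg α)) := by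
  rcases Nat.eq_zero_or_pos ν with h | h
  · obtain ⟨g1, g2, g3⟩ := h0 h
    subst h
    refine ⟨g1, g2, fun α hα x => ?_⟩
    simpa using g3 α hα x
  · obtain ⟨g1, g2, g3, _⟩ := h1 h
    refine ⟨g1, g2, fun α hα x => (g3 α hα x).trans (le_of_eq ?_)⟩
    rw [Real.rpow_add (by norm_num), ← Real.rpow_natCast]
    push_cast
    rw [mul_comm (ν:ℝ) (mdeg α : ℝ)]

lemma tl_atom_est {φ : ℕ → Sch n} (hφ : SmoothResolution n φ) {s : ℝ} {p : ℝ≥0∞} {K : ℕ} {L : ℤ}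
    {d : ℝ} (hd : 1 < d) (hL : -1 ≤ L) (hK : s < K) {M : ℝ} (hM0 : 0 ≤ M)
    (hM : M < L + 1 + n + s) :
    ∃ ε > (0:ℝ), ∃ C ≥ (0:ℝ), ∀ (j ν : ℕ) (m : Fin n → ℤ) (a : Rn n → E),
      (ν = 0 → Is1Atom K d m a) → (0 < ν → IsSPAtom s p K L d ν m a) → ∀ x,
      (2:ℝ) ^ ((j:ℝ) * s) * ‖∫ y, shiftReflect (invFourierS (φ j)) x y • a y‖ ≤
        C * (2:ℝ) ^ (-ε * |(j:ℝ) - ν|) * ((2:ℝ) ^ ((ν:ℝ) * n / p.toReal) *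
          (1 + ‖(2:ℝ)^ν • x - zpt m‖) ^ (-M)) := by
  obtain ⟨M0, hMM0⟩ := exists_nat_ge M
  obtain ⟨k, hk⟩ : ∃ k : ℕ, (k : ℤ) = L + 1 := ⟨(L+1).toNat, Int.toNat_of_nonneg (by omega)⟩
  have hkr : (k:ℝ) = L + 1 := by exact_mod_cast hk
  obtain ⟨C1, hC1, H1⟩ := tl_atom_hi (E := E) hφ K M0 hd
  obtain ⟨C2, hC2, H2⟩ := tl_atom_hi (E := E) hφ 0 M0 hd
  obtain ⟨C3, hC3, H3⟩ := tl_atom_lo (E := E) hφ k M0 hd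
  have hε : 0 < min ((K:ℝ) - s) (k + n + s - M) := by
    apply lt_min <;> linarith
  refine ⟨min ((K:ℝ) - s) (k + n + s - M), hε, C1 + C2 + C3, by positivity, ?_⟩
  set ε := min ((K:ℝ) - s) (k + n + s - M) with hεd
  have hε1 : ε ≤ (K:ℝ) - s := min_le_left _ _
  have hε2 : ε ≤ k + n + s - M := min_le_right _ _
  intro j ν m a h0 h1 x
  obtain ⟨g1, g2, g3⟩ := tl_unify ν m a h0 h1
  set b : ℝ := (2:ℝ) ^ (-(ν : ℝ) * (s - (n : ℝ) / p.toReal)) with hb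
  have hb0 : 0 ≤ b := by positivity
  set X := ‖(2:ℝ)^ν • x - zpt m‖ with hX
  have hX0 : 0 ≤ X := norm_nonneg _
  have hdec : ((1 + X) ^ M0)⁻¹ ≤ (1+X) ^ (-M) := tl_pow_rpow_le hMM0 (by linarith)
  have hzero : ∀ x, ‖a x‖ ≤ b := by
    intro x
    have h5 := g3 (fun _ => 0) (by simp [mdeg]) x
    have h6 : mderiv (fun _ => 0) a = a := by
      unfold mderiv
      induction List.finRange n with
      | nil => rfl
      | cons i l ih => simpa using ih
    rw [h6] at h5
    simpa [mdeg] using h5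
  have two : (0:ℝ) < 2 := by norm_num
  rcases le_or_gt ν j with hνj | hνj
  · rcases Nat.eq_zero_or_pos j with hj | hj
    · have hν : ν = 0 := by omega
      have h5 := H2 j ν hνj (Or.inr rfl) m a b hb0 (by simpa using g1.continuous) g2
        (fun α hα x => by have h7 := g3 α (by omega) x; rw [hα] at h7; exact h7) x
      subst hj
      subst hν
      simp only [pow_zero, mul_one, CharP.cast_eq_zero, zero_mul, Real.rpow_zero, one_mul, sub_self,
        abs_zero, mul_zero, zero_div, one_smul] at *
      refine h5.trans ?_
      have hb1 : b = 1 := by simp [hb]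
      rw [hb1, mul_one]
      rw [← hX]
      calc _ ≤ C2 * (1+X)^(-M) := mul_le_mul_of_nonneg_left hdec hC2
        _ ≤ _ := by
          refine mul_le_mul_of_nonneg_right (by linarith) (by positivity)
    · have h5 := H1 j ν hνj (Or.inl hj) m a b hb0 g1 g2
        (fun α hα x => by rw [← hα]; exact g3 α (by omega) x) x
      have hνj' : (ν:ℝ) ≤ j := by exact_mod_cast hνj
      have e1 : (2:ℝ) ^ ((j:ℝ) * s) * (b * (((2:ℝ)^j * ((2:ℝ)^ν)⁻¹)⁻¹)^K) =
          (2:ℝ) ^ (-((K:ℝ)-s) * |(j:ℝ) - ν|) * (2:ℝ) ^ ((ν:ℝ) * n / p.toReal) := by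
        rw [abs_of_nonneg (by linarith), hb, ← Real.rpow_natCast 2 j, ← Real.rpow_natCast 2 ν,
          ← Real.rpow_neg two.le, ← Real.rpow_add two, ← Real.rpow_neg two.le, ← Real.rpow_natCast,
          ← Real.rpow_mul two.le, ← Real.rpow_add two, ← Real.rpow_add two, ← Real.rpow_add two]
        congr 1
        ring
      calc _ ≤ (2:ℝ) ^ ((j:ℝ) * s) * (C1 * b * (((2:ℝ)^j * ((2:ℝ)^ν)⁻¹)⁻¹)^K * ((1 + X) ^ M0)⁻¹) := by
            gcongr
        _ = C1 * ((2:ℝ) ^ ((j:ℝ) * s) * (b * (((2:ℝ)^j * ((2:ℝ)^ν)⁻¹)⁻¹)^K)) * ((1 + X) ^ M0)⁻¹ := by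
            ring
        _ = C1 * (2:ℝ) ^ (-((K:ℝ)-s) * |(j:ℝ) - ν|) * ((2:ℝ) ^ ((ν:ℝ) * n / p.toReal) *
              ((1 + X) ^ M0)⁻¹) := by rw [e1]; ring
        _ ≤ _ := by
            gcongr
            · linarith
            · norm_num
  · obtain ⟨_, _, _, g4⟩ := h1 (by omega)
    have h5 := H3 j ν hνj.le m a b g1.continuous g2 hzero (fun β hβ => g4 β (by omega)) x
    have hνj' : (j:ℝ) ≤ ν := by exact_mod_cast hνj.le
    set t := (2:ℝ)^j * ((2:ℝ)^ν)⁻¹ with ht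
    have ht2 : t = (2:ℝ) ^ ((j:ℝ) - ν) := by
      rw [ht, ← Real.rpow_natCast 2 j, ← Real.rpow_natCast 2 ν, ← Real.rpow_neg two.le,
        ← Real.rpow_add two]
      congr 1
    have ht0 : 0 < t := by positivity
    have ht1 : t ≤ 1 := by
      rw [ht2]; exact Real.rpow_le_one_of_one_le_of_nonpos (by norm_num) (by linarith)
    have hdec2 : ((1 + t * X) ^ M0)⁻¹ ≤ t ^ (-M) * (1+X) ^ (-M) := by
      refine (tl_pow_rpow_le hMM0 (by nlinarith [mul_nonneg ht0.le hX0])).trans ?_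
      rw [← Real.mul_rpow ht0.le (by linarith)]
      refine Real.rpow_le_rpow_of_nonpos (by positivity) ?_ (by linarith)
      nlinarith
    have e1 : (2:ℝ) ^ ((j:ℝ) * s) * (b * t^(n+k) * t^(-M)) =
          (2:ℝ) ^ (-(k + n + s - M) * |(j:ℝ) - ν|) * (2:ℝ) ^ ((ν:ℝ) * n / p.toReal) := by
      rw [abs_of_nonpos (by linarith), hb, ht2, ← Real.rpow_natCast,
          ← Real.rpow_mul two.le, ← Real.rpow_mul two.le, ← Real.rpow_add two, ← Real.rpow_add two,
          ← Real.rpow_add two, ← Real.rpow_add two]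
      congr 1
      push_cast
      ring
    calc _ ≤ (2:ℝ) ^ ((j:ℝ) * s) * (C3 * b * t^(n+k) * ((1 + t * X) ^ M0)⁻¹) := by
            gcongr
      _ ≤ (2:ℝ) ^ ((j:ℝ) * s) * (C3 * b * t^(n+k) * (t ^ (-M) * (1+X) ^ (-M))) := by
            gcongr
      _ = C3 * ((2:ℝ) ^ ((j:ℝ) * s) * (b * t^(n+k) * t^(-M))) * (1+X) ^ (-M) := by
            ring
      _ = C3 * (2:ℝ) ^ (-(k + n + s - M) * |(j:ℝ) - ν|) * ((2:ℝ) ^ ((ν:ℝ) * n / p.toReal) *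
              (1+X) ^ (-M)) := by rw [e1]; ring
      _ ≤ _ := by
            gcongr
            · linarith
            · norm_num

end TLAtomEst

section TLMax

def tlMF (h : Rn n → ℝ≥0∞) (x : Rn n) : ℝ≥0∞ :=
  ⨆ (z : Rn n) (ρ : ℝ) (_ : x ∈ ball z ρ), (volume (ball z ρ))⁻¹ * ∫⁻ y in ball z ρ, h y

lemma tl_lt_MF {h : Rn n → ℝ≥0∞} {x : Rn n} {c : ℝ≥0∞} : c < tlMF h x ↔
    ∃ (z : Rn n) (ρ : ℝ), x ∈ ball z ρ ∧ c < (volume (ball z ρ))⁻¹ * ∫⁻ y in ball z ρ, h y := by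
  simp only [tlMF, lt_iSup_iff, exists_prop]

lemma tl_MF_measurable (h : Rn n → ℝ≥0∞) : Measurable (tlMF h) := by
  apply LowerSemicontinuous.measurable
  rw [lowerSemicontinuous_iff_isOpen_preimage]
  intro c
  rw [isOpen_iff_mem_nhds]
  intro x hx
  obtain ⟨z, ρ, hx1, hx2⟩ := tl_lt_MF.1 (show c < tlMF h x from hx)
  filter_upwards [isOpen_ball.mem_nhds hx1] with y hy
  exact tl_lt_MF.2 ⟨z, ρ, hy, hx2⟩

lemma tl_ball_le_MF (h : Rn n → ℝ≥0∞) (x : Rn n) {ρ : ℝ} (hρ : 0 < ρ) :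
    ∫⁻ y in ball x ρ, h y ≤ volume (ball x ρ) * tlMF h x := by
  have h1 : (volume (ball x ρ))⁻¹ * ∫⁻ y in ball x ρ, h y ≤ tlMF h x := by
    unfold tlMF
    exact le_iSup_of_le x (le_iSup_of_le ρ (le_iSup_of_le (mem_ball_self hρ) le_rfl))
  rw [← ENNReal.div_eq_inv_mul] at h1
  have := (ENNReal.div_le_iff_le_mul (Or.inl (measure_ball_pos volume x hρ).ne')
    (Or.inl measure_ball_lt_top.ne)).1 h1
  rwa [mul_comm]

lemma tl_MF_mono {h g : Rn n → ℝ≥0∞} (hg : ∀ x, h x ≤ g x) (x : Rn n) : tlMF h x ≤ tlMF g x := by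
  unfold tlMF
  gcongr with z ρ hx
  exact hg _

lemma tl_MF_const (c : ℝ≥0∞) (x : Rn n) : tlMF (fun _ => c) x ≤ c := by
  unfold tlMF
  refine iSup_le fun z => iSup_le fun ρ => iSup_le fun hx => ?_
  rw [setLIntegral_const, mul_comm c, ← mul_assoc]
  exact (mul_le_mul_left (ENNReal.inv_mul_le_one _) c).trans (one_mul c).le

lemma tl_weak (h : Rn n → ℝ≥0∞) (c : ℝ≥0∞) :
    c * volume {x | c < tlMF h x} ≤ (5:ℝ≥0∞)^n * ∫⁻ y, h y := by
  let t : ℕ → Set (Rn n × ℝ) := fun R => {i | 0 < i.2 ∧ i.2 ≤ R ∧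
    c < (volume (ball i.1 i.2))⁻¹ * ∫⁻ y in ball i.1 i.2, h y}
  have hU : {x | c < tlMF h x} = ⋃ R : ℕ, ⋃ i ∈ t R, ball i.1 i.2 := by
    ext x
    simp only [Set.mem_ofPred_eq, tl_lt_MF, mem_iUnion, t]
    constructor
    · rintro ⟨z, ρ, hx, hlt⟩
      obtain ⟨R, hR⟩ := exists_nat_ge ρ
      exact ⟨R, (z, ρ), ⟨pos_of_mem_ball hx, hR, hlt⟩, hx⟩
    · rintro ⟨R, i, ⟨_, _, hlt⟩, hx⟩
      exact ⟨i.1, i.2, hx, hlt⟩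
  have hmono : Monotone fun R : ℕ => ⋃ i ∈ t R, ball i.1 i.2 := by
    intro R R' hRR
    refine biUnion_subset_biUnion_left ?_
    rintro i ⟨h1, h2, h3⟩
    exact ⟨h1, h2.trans (by exact_mod_cast hRR), h3⟩
  rw [hU, hmono.measure_iUnion, ENNReal.mul_iSup]
  refine iSup_le fun R => ?_
  obtain ⟨u, hut, hdis, hcov⟩ := Vitali.exists_disjoint_subfamily_covering_enlargement_closedBall
    (t R) (fun i => i.1) (fun i => i.2) R (fun i hi => hi.2.1) 5 (by norm_num)
  have hucount : u.Countable := by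
    refine hdis.countable_of_nonempty_interior fun i hi => ?_
    exact (nonempty_ball.2 (hut hi).1).mono ball_subset_interior_closedBall
  have hsub : (⋃ i ∈ t R, ball i.1 i.2) ⊆ ⋃ b ∈ u, closedBall b.1 (5 * b.2) := by
    refine iUnion₂_subset fun i hi => ?_
    obtain ⟨b, hb, hb2⟩ := hcov i hi
    exact (ball_subset_closedBall.trans hb2).trans (subset_biUnion_of_mem
      (u := fun b : Rn n × ℝ => closedBall b.1 (5 * b.2)) hb)
  have hdis2 : u.PairwiseDisjoint fun i => ball i.1 i.2 :=
    hdis.mono fun i => ball_subset_closedBall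
  have hone : ∀ i ∈ u, c * volume (closedBall i.1 (5 * i.2)) ≤
      (5:ℝ≥0∞)^n * ∫⁻ y in ball i.1 i.2, h y := by
    intro i hi
    have hpos := (hut hi).1
    have hlt := (hut hi).2.2
    rw [Measure.addHaar_closedBall volume _ (by positivity : 0 ≤ 5 * i.2), mul_pow,
      ENNReal.ofReal_mul (by positivity), mul_assoc]
    have h5 : volume (ball i.1 i.2) = ENNReal.ofReal (i.2 ^ Module.finrank ℝ (Rn n)) *
      volume (ball (0 : Rn n) 1) := Measure.addHaar_ball_of_pos volume _ hpos
    rw [← h5, finrank_euclideanSpace_fin, ENNReal.ofReal_pow (by norm_num)]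
    have h6 : c * volume (ball i.1 i.2) ≤ ∫⁻ y in ball i.1 i.2, h y := by
      rw [← ENNReal.div_eq_inv_mul] at hlt
      exact (ENNReal.le_div_iff_mul_le (Or.inl (measure_ball_pos volume _ hpos).ne')
        (Or.inl measure_ball_lt_top.ne)).1 hlt.le
    calc _ = (5:ℝ≥0∞)^n * (c * volume (ball i.1 i.2)) := by
          rw [show ENNReal.ofReal 5 = 5 by simp]; ring
      _ ≤ _ := by gcongr
  calc c * volume (⋃ i ∈ t R, ball i.1 i.2)
      ≤ c * ∑' i : u, volume (closedBall i.1.1 (5 * i.1.2)) := by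
        gcongr
        exact (measure_mono hsub).trans (measure_biUnion_le _ hucount _)
    _ = ∑' i : u, c * volume (closedBall i.1.1 (5 * i.1.2)) := ENNReal.tsum_mul_left.symm
    _ ≤ ∑' i : u, (5:ℝ≥0∞)^n * ∫⁻ y in ball i.1.1 i.1.2, h y :=
        ENNReal.tsum_le_tsum fun i => hone i.1 i.2
    _ = (5:ℝ≥0∞)^n * ∫⁻ y in ⋃ i ∈ u, ball i.1 i.2, h y := by
        rw [ENNReal.tsum_mul_left, lintegral_biUnion hucount (fun i _ => measurableSet_ball) hdis2]
    _ ≤ _ := by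
        gcongr
        exact Measure.restrict_le_self

def tlJ (t : ℝ) (a : ℝ≥0∞) : ℝ≥0∞ :=
  ∫⁻ τ in Ioi (0:ℝ), {τ : ℝ | ENNReal.ofReal τ < a}.indicator (fun τ => ENNReal.ofReal (τ ^ (t - 1))) τ

lemma tlJ_mono (t : ℝ) {a b : ℝ≥0∞} (h : a ≤ b) : tlJ t a ≤ tlJ t b := by
  unfold tlJ
  refine lintegral_mono fun τ => ?_
  refine indicator_le_indicator_of_subset (fun x hx => lt_of_lt_of_le hx h) (by simp) _

lemma tlJ_eq {t : ℝ} (ht : 0 < t) {a : ℝ≥0∞} (ha : a ≠ ∞) : a ^ t = ENNReal.ofReal t * tlJ t a := by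
  have h := lintegral_rpow_eq_lintegral_meas_lt_mul (Measure.dirac ()) (f := fun _ => a.toReal)
    (Eventually.of_forall fun _ => ENNReal.toReal_nonneg) (by fun_prop) ht
  simp only [lintegral_dirac] at h
  rw [← ENNReal.ofReal_rpow_of_nonneg ENNReal.toReal_nonneg ht.le, ENNReal.ofReal_toReal ha] at h
  rw [h, tlJ]
  congr 1
  refine setLIntegral_congr_fun measurableSet_Ioi fun τ hτ => ?_
  have hiff : ENNReal.ofReal τ < a ↔ τ < a.toReal := ENNReal.ofReal_lt_iff_lt_toReal (le_of_lt hτ) ha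
  by_cases h1 : τ < a.toReal
  · simp [indicator, hiff, h1]
  · simp [indicator, hiff, h1]

lemma tlJ_top {t : ℝ} (ht : 0 < t) : ENNReal.ofReal t * tlJ t ∞ = ∞ := by
  by_contra hne
  set B := ENNReal.ofReal t * tlJ t ∞
  have h : ∀ a : ℝ≥0∞, a ≠ ∞ → a ^ t ≤ B := fun a ha => by
    rw [tlJ_eq ht ha]
    exact mul_le_mul_right (tlJ_mono t le_top) _
  have h2 := h ((B + 1) ^ t⁻¹) (by
    apply ENNReal.rpow_ne_top_of_nonneg (by positivity); simp [hne])
  rw [ENNReal.rpow_inv_rpow ht.ne'] at h2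
  exact absurd h2 (not_le.2 (ENNReal.lt_add_right hne one_ne_zero))

lemma tlJ_eq' {t : ℝ} (ht : 0 < t) (a : ℝ≥0∞) : a ^ t = ENNReal.ofReal t * tlJ t a := by
  rcases eq_or_ne a ∞ with rfl | ha
  · rw [tlJ_top ht, ENNReal.top_rpow_of_pos ht]
  · exact tlJ_eq ht ha

lemma tl_layer {t : ℝ} (ht : 0 < t) {F : Rn n → ℝ≥0∞} (hF : Measurable F) (w : Rn n → ℝ≥0∞)
    (hw : Measurable w) :
    ∫⁻ x, w x * F x ^ t = ENNReal.ofReal t * ∫⁻ τ in Ioi (0:ℝ), ENNReal.ofReal (τ ^ (t - 1)) *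
      ∫⁻ x in {x | ENNReal.ofReal τ < F x}, w x := by
  have h1 : ∀ x, w x * F x ^ t = ENNReal.ofReal t * ∫⁻ τ in Ioi (0:ℝ),
      {q : Rn n × ℝ | ENNReal.ofReal q.2 < F q.1}.indicator
        (fun q => w q.1 * ENNReal.ofReal (q.2 ^ (t - 1))) (x, τ) := by
    intro x
    rw [tlJ_eq' ht, mul_left_comm, tlJ, ← lintegral_const_mul]
    · congr 1
      refine lintegral_congr fun τ => ?_
      simp only [indicator, Set.mem_ofPred_eq]
      split_ifs <;> simp
    · refine Measurable.indicator (by fun_prop) ?_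
      exact measurableSet_lt (by fun_prop) (by fun_prop)
  have hm : Measurable ({q : Rn n × ℝ | ENNReal.ofReal q.2 < F q.1}.indicator
        (fun q => w q.1 * ENNReal.ofReal (q.2 ^ (t - 1)))) := by
    refine Measurable.indicator (by fun_prop) ?_
    exact measurableSet_lt (by fun_prop) (by fun_prop)
  simp_rw [h1]
  rw [lintegral_const_mul]
  · congr 1
    rw [lintegral_lintegral_swap]
    · refine lintegral_congr fun τ => ?_
      have hms : MeasurableSet {x | ENNReal.ofReal τ < F x} := measurableSet_lt (by fun_prop) hF
      rw [← lintegral_indicator hms, ← lintegral_const_mul _ (hw.indicator hms)]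
      refine lintegral_congr fun x => ?_
      simp only [indicator, Set.mem_ofPred_eq]
      split_ifs <;> simp [mul_comm]
    · exact hm.aemeasurable
  · exact Measurable.lintegral_prod_right' hm

lemma tl_strong {t : ℝ} (ht : 1 < t) : ∃ C : ℝ≥0∞, C ≠ ∞ ∧ ∀ h : Rn n → ℝ≥0∞, Measurable h →
    ∫⁻ x, tlMF h x ^ t ≤ C * ∫⁻ x, h x ^ t := by
  refine ⟨(2:ℝ≥0∞)^t * (ENNReal.ofReal t * ((5:ℝ≥0∞)^n * (ENNReal.ofReal (t-1))⁻¹)), ?_, fun h hh => ?_⟩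
  · have : ENNReal.ofReal (t - 1) ≠ 0 := by simp; linarith
    have h2 : (2:ℝ≥0∞)^t ≠ ∞ := ENNReal.rpow_ne_top_of_nonneg (by linarith) (by simp)
    finiteness
  have hsub : ∀ (τ : ℝ), 0 < τ → ∀ x, ENNReal.ofReal τ < 2⁻¹ * tlMF h x →
      ENNReal.ofReal τ < tlMF ({y | ENNReal.ofReal τ < h y}.indicator h) x := by
    intro τ hτ x hx
    by_contra hcon
    push Not at hcon
    have h1 : tlMF h x ≤ ENNReal.ofReal τ + ENNReal.ofReal τ := by
      rw [tlMF]
      refine iSup_le fun z => iSup_le fun ρ => iSup_le fun hxb => ?_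
      have h2 : (volume (ball z ρ))⁻¹ * ∫⁻ y in ball z ρ, {y | ENNReal.ofReal τ < h y}.indicator h y
          ≤ ENNReal.ofReal τ := by
        refine le_trans ?_ hcon
        exact le_iSup_of_le z (le_iSup_of_le ρ (le_iSup_of_le hxb le_rfl))
      have h3 : (volume (ball z ρ))⁻¹ * ∫⁻ y in ball z ρ, ENNReal.ofReal τ ≤ ENNReal.ofReal τ := by
        refine le_trans ?_ (tl_MF_const (ENNReal.ofReal τ) x)
        exact le_iSup_of_le z (le_iSup_of_le ρ (le_iSup_of_le hxb le_rfl))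
      refine le_trans ?_ (add_le_add h2 h3)
      rw [← mul_add, ← lintegral_add_right _ measurable_const]
      gcongr with y
      by_cases hy : ENNReal.ofReal τ < h y
      · simp [indicator, hy]
      · simp only [indicator, Set.mem_ofPred_eq, hy, if_false, zero_add]
        exact not_lt.1 hy
    have h4 : 2⁻¹ * tlMF h x ≤ ENNReal.ofReal τ := by
      calc _ ≤ 2⁻¹ * (ENNReal.ofReal τ + ENNReal.ofReal τ) := by gcongr
        _ = _ := by
          rw [← two_mul, ← mul_assoc, ENNReal.inv_mul_cancel (by simp) (by simp), one_mul]
    exact absurd hx (not_lt.2 h4)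
  have hM : Measurable fun x => 2⁻¹ * tlMF h x := (tl_MF_measurable h).const_mul _
  have h1 := tl_layer (by linarith : 0 < t) hM (fun _ => 1) measurable_const
  have h2 := tl_layer (by linarith : 0 < t - 1) hh h hh
  have h3 : ∫⁻ x, tlMF h x ^ t = (2:ℝ≥0∞)^t * ∫⁻ x, 1 * (2⁻¹ * tlMF h x) ^ t := by
    rw [← lintegral_const_mul]
    · refine lintegral_congr fun x => ?_
      rw [one_mul, ← ENNReal.mul_rpow_of_nonneg _ _ (by linarith), ← mul_assoc,
        ENNReal.mul_inv_cancel (by simp) (by simp), one_mul]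
    · exact (hM.pow_const t).const_mul 1
  have h4 : ∫⁻ x, h x * h x ^ (t-1) = ∫⁻ x, h x ^ t := by
    refine lintegral_congr fun x => ?_
    nth_rewrite 1 [← ENNReal.rpow_one (h x)]
    rw [← ENNReal.rpow_add_of_nonneg _ _ (by norm_num) (by linarith)]
    congr 1; ring
  rw [h3, h1, ← h4, h2, mul_assoc, mul_assoc, mul_assoc]
  gcongr (2:ℝ≥0∞)^t * (ENNReal.ofReal t * ?_)
  rw [← mul_assoc (ENNReal.ofReal (t-1))⁻¹, ENNReal.inv_mul_cancel (by simp; linarith) (by simp),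
    one_mul, ← lintegral_const_mul']
  swap
  · finiteness
  refine setLIntegral_mono_ae' measurableSet_Ioi (Eventually.of_forall fun τ hτ => ?_)
  have hτ' : (0:ℝ) < τ := hτ
  have hms : MeasurableSet {x | ENNReal.ofReal τ < h x} := measurableSet_lt (by fun_prop) hh
  have h5 := tl_weak ({y | ENNReal.ofReal τ < h y}.indicator h) (ENNReal.ofReal τ)
  rw [lintegral_indicator hms] at h5
  have h6 : ENNReal.ofReal τ * ∫⁻ x in {x | ENNReal.ofReal τ < 2⁻¹ * tlMF h x}, 1 ≤
      (5:ℝ≥0∞)^n * ∫⁻ x in {x | ENNReal.ofReal τ < h x}, h x := by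
    refine le_trans ?_ h5
    rw [setLIntegral_one]
    exact mul_le_mul_right (measure_mono fun x hx => hsub τ hτ' x hx) _
  have h7 : ENNReal.ofReal (τ ^ (t-1)) = ENNReal.ofReal (τ^(t-1-1)) * ENNReal.ofReal τ := by
    rw [← ENNReal.ofReal_mul (by positivity)]
    congr 1
    rw [← Real.rpow_add_one hτ'.ne']
    congr 1; ring
  rw [h7, mul_assoc, mul_left_comm ((5:ℝ≥0∞)^n)]
  exact mul_le_mul_right h6 _

end TLMax

section TLAv

lemma tl_holder {α : Type*} [MeasurableSpace α] (μ : Measure α) {u : ℝ} (hu : 1 < u)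
    {f g : α → ℝ≥0∞} (hf : AEMeasurable f μ) (hg : AEMeasurable g μ) :
    (∫⁻ x, f x * g x ∂μ) ^ u ≤ (∫⁻ x, f x ^ u ∂μ) * (∫⁻ x, g x ^ (u / (u-1)) ∂μ) ^ (u - 1) := by
  have hpq : u.HolderConjugate (u/(u-1)) := Real.HolderConjugate.conjExponent hu
  have h := ENNReal.lintegral_mul_le_Lp_mul_Lq μ hpq hf hg
  have hu0 : 0 < u := by linarith
  have hu1 : 0 < u - 1 := by linarith
  calc _ ≤ ((∫⁻ x, f x ^ u ∂μ) ^ (1/u) * (∫⁻ x, g x ^ (u / (u-1)) ∂μ) ^ (1/(u/(u-1)))) ^ u := by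
        gcongr
        exact h
    _ = _ := by
        rw [ENNReal.mul_rpow_of_nonneg _ _ hu0.le, ← ENNReal.rpow_mul, ← ENNReal.rpow_mul]
        congr 2
        · rw [show 1 / u * u = 1 by field_simp, ENNReal.rpow_one]
        · field_simp

lemma tl_jensen {α : Type*} [MeasurableSpace α] (μ : Measure α) {u : ℝ} (hu : 1 < u)
    {g : α → ℝ≥0∞} (hg : AEMeasurable g μ) :
    (∫⁻ x, g x ∂μ) ^ u ≤ (μ univ) ^ (u - 1) * (∫⁻ x, g x ^ u ∂μ) := by
  have h := tl_holder μ hu hg (g := fun _ => 1) aemeasurable_const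
  simpa [mul_comm] using h

lemma tl_conv_seq {δ : ℝ} (hδ : 0 < δ) : ∃ C : ℝ≥0∞, C ≠ ∞ ∧ ∀ j : ℕ,
    ∑' ν : ℕ, ENNReal.ofReal ((2:ℝ) ^ (-δ * |(j:ℝ) - ν|)) ≤ C := by
  have h1 : Summable fun i : ℤ => (2:ℝ) ^ (-δ * |(i:ℝ)|) := by
    have h2 : Summable fun i : ℕ => (2:ℝ) ^ (-δ * |((i:ℤ):ℝ)|) := by
      have : (fun i : ℕ => (2:ℝ) ^ (-δ * |((i:ℤ):ℝ)|)) = fun i : ℕ => ((2:ℝ)^(-δ))^i := by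
        funext i
        rw [← Real.rpow_natCast, ← Real.rpow_mul (by norm_num)]
        simp
      rw [this]
      apply summable_geometric_of_lt_one (by positivity)
      exact Real.rpow_lt_one_of_one_lt_of_neg (by norm_num) (by linarith)
    exact Summable.of_nat_of_neg h2 (by simpa using h2)
  refine ⟨∑' i : ℤ, ENNReal.ofReal ((2:ℝ) ^ (-δ * |(i:ℝ)|)), ?_, fun j => ?_⟩
  · rw [← ENNReal.ofReal_tsum_of_nonneg (fun i => by positivity) h1]
    simp
  · have h3 : Function.Injective fun ν : ℕ => (j:ℤ) - ν := fun a b h => by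
      simp only at h; omega
    have := ENNReal.tsum_comp_le_tsum_of_injective h3
      (fun i : ℤ => ENNReal.ofReal ((2:ℝ) ^ (-δ * |(i:ℝ)|)))
    simpa using this

lemma tl_seq_young {δ u : ℝ} (hδ : 0 < δ) (hu : 1 < u) : ∃ C : ℝ≥0∞, C ≠ ∞ ∧ ∀ c : ℕ → ℝ≥0∞,
    ∑' j : ℕ, (∑' ν : ℕ, ENNReal.ofReal ((2:ℝ) ^ (-δ * |(j:ℝ) - ν|)) * c ν) ^ u ≤
      C * ∑' ν, c ν ^ u := by
  obtain ⟨C, hC, hb⟩ := tl_conv_seq hδ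
  refine ⟨C ^ (u-1) * C, ?_, fun c => ?_⟩
  · have := ENNReal.rpow_ne_top_of_nonneg (by linarith : 0 ≤ u - 1) hC
    finiteness
  have h1 : ∀ j : ℕ, (∑' ν : ℕ, ENNReal.ofReal ((2:ℝ) ^ (-δ * |(j:ℝ) - ν|)) * c ν) ^ u ≤
      C ^ (u-1) * ∑' ν : ℕ, ENNReal.ofReal ((2:ℝ) ^ (-δ * |(j:ℝ) - ν|)) * c ν ^ u := by
    intro j
    have h := tl_jensen (Measure.count.withDensity
      fun ν : ℕ => ENNReal.ofReal ((2:ℝ) ^ (-δ * |(j:ℝ) - ν|))) hu (g := c)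
      (measurable_of_countable _).aemeasurable
    rw [lintegral_withDensity_eq_lintegral_mul _ (measurable_of_countable _)
      (measurable_of_countable _), lintegral_withDensity_eq_lintegral_mul _
      (measurable_of_countable _) (measurable_of_countable _),
      withDensity_apply _ MeasurableSet.univ, Measure.restrict_univ,
      lintegral_count, lintegral_count, lintegral_count] at h
    refine h.trans ?_
    simp only [Pi.mul_apply]
    gcongr
    exact hb j
  calc _ ≤ ∑' j : ℕ, C ^ (u-1) * ∑' ν : ℕ, ENNReal.ofReal ((2:ℝ) ^ (-δ * |(j:ℝ) - ν|)) * c ν ^ u :=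
        ENNReal.tsum_le_tsum h1
    _ = C ^ (u-1) * ∑' ν : ℕ, (∑' j : ℕ, ENNReal.ofReal ((2:ℝ) ^ (-δ * |(j:ℝ) - ν|))) * c ν ^ u := by
        rw [ENNReal.tsum_mul_left, ENNReal.tsum_comm]
        simp_rw [ENNReal.tsum_mul_right]
    _ ≤ C ^ (u-1) * ∑' ν : ℕ, C * c ν ^ u := by
        gcongr with ν
        refine le_trans (ENNReal.tsum_le_tsum fun j => ?_) (hb ν)
        rw [abs_sub_comm]
    _ = _ := by rw [ENNReal.tsum_mul_left, mul_assoc]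

def tlKer (N : ℝ) (ν : ℕ) (x y : Rn n) : ℝ≥0∞ :=
  ENNReal.ofReal (((2:ℝ)^ν)^n * (1 + (2:ℝ)^ν * ‖x - y‖) ^ (-N))

def tlAv (N : ℝ) (ν : ℕ) (h : Rn n → ℝ≥0∞) (x : Rn n) : ℝ≥0∞ := ∫⁻ y, tlKer N ν x y * h y

lemma tlKer_symm (N : ℝ) (ν : ℕ) (x y : Rn n) : tlKer N ν x y = tlKer N ν y x := by
  simp only [tlKer, norm_sub_rev]

lemma tlKer_measurable (N : ℝ) (ν : ℕ) :
    Measurable fun z : Rn n × Rn n => tlKer N ν z.1 z.2 := by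
  unfold tlKer
  fun_prop

lemma tlKer_measurable_right (N : ℝ) (ν : ℕ) (x : Rn n) :
    Measurable fun y : Rn n => tlKer N ν x y := by
  unfold tlKer
  fun_prop

lemma tlAv_measurable (N : ℝ) (ν : ℕ) {h : Rn n → ℝ≥0∞} (hh : Measurable h) :
    Measurable (tlAv N ν h) := by
  unfold tlAv
  exact Measurable.lintegral_prod_right' (f := fun z : Rn n × Rn n => tlKer N ν z.1 z.2 * h z.2)
    ((tlKer_measurable N ν).mul (hh.comp measurable_snd))

lemma tlAv_eq (N : ℝ) (ν : ℕ) {h : Rn n → ℝ≥0∞} (hh : Measurable h) (x : Rn n) :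
    tlAv N ν h x = ∫⁻ y, h y ∂(volume.withDensity (tlKer N ν x)) := by
  rw [lintegral_withDensity_eq_lintegral_mul _ (tlKer_measurable_right N ν x) hh]
  rfl

lemma tl_decay_dyadic {N : ℝ} (hN : 0 < N) {τ : ℝ} (hτ : 0 ≤ τ) :
    ∃ k : ℕ, τ < 2 ^ k ∧ (1 + τ) ^ (-N) ≤ (2:ℝ) ^ N * ((2:ℝ) ^ (-N)) ^ k := by
  have hex : ∃ k : ℕ, τ < 2 ^ k := pow_unbounded_of_one_lt τ (by norm_num)
  classical
  refine ⟨Nat.find hex, Nat.find_spec hex, ?_⟩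
  rcases hk : Nat.find hex with _ | k
  · simp only [pow_zero, mul_one]
    calc (1+τ) ^ (-N) ≤ 1 := Real.rpow_le_one_of_one_le_of_nonpos (by linarith) (by linarith)
      _ ≤ _ := Real.one_le_rpow (by norm_num) hN.le
  · have h1 : (2:ℝ)^k ≤ τ := by
      have := Nat.find_min hex (m := k) (by omega)
      exact not_lt.1 this
    calc (1+τ) ^ (-N) ≤ ((2:ℝ)^k) ^ (-N) :=
          Real.rpow_le_rpow_of_nonpos (by positivity) (by linarith) (by linarith)
      _ = _ := by
          rw [← Real.rpow_natCast, ← Real.rpow_natCast, ← Real.rpow_mul (by norm_num),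
            ← Real.rpow_mul (by norm_num), ← Real.rpow_add (by norm_num)]
          congr 1
          push_cast
          ring

lemma tl_Av_le_MF {N : ℝ} (hN : (n:ℝ) < N) : ∃ C : ℝ≥0∞, C ≠ ∞ ∧ ∀ (ν : ℕ) (h : Rn n → ℝ≥0∞),
    Measurable h → ∀ x, tlAv N ν h x ≤ C * tlMF h x := by
  have hN0 : 0 < N := lt_of_le_of_lt (Nat.cast_nonneg n) hN
  let c : ℕ → ℝ := fun k => (2:ℝ) ^ N * ((2:ℝ) ^ (-N)) ^ k
  have hc : ∀ k, 0 ≤ c k := fun k => by positivity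
  have hsum : Summable fun k : ℕ => c k * ((2:ℝ)^k)^n := by
    have : (fun k : ℕ => c k * ((2:ℝ)^k)^n) = fun k => (2:ℝ)^N * ((2:ℝ)^(-N + n))^k := by
      funext k
      simp only [c]
      rw [Real.rpow_add (by norm_num), mul_pow, mul_assoc, Real.rpow_natCast]
      congr 2
      rw [← pow_mul, ← pow_mul, mul_comm]
    rw [this]
    apply Summable.mul_left
    apply summable_geometric_of_lt_one (by positivity)
    exact Real.rpow_lt_one_of_one_lt_of_neg (by norm_num) (by linarith)
  refine ⟨(∑' k : ℕ, ENNReal.ofReal (c k * ((2:ℝ)^k)^n)) * volume (ball (0 : Rn n) 1), ?_, ?_⟩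
  · rw [← ENNReal.ofReal_tsum_of_nonneg (fun i => by positivity) hsum]
    have : volume (ball (0 : Rn n) 1) ≠ ∞ := measure_ball_lt_top.ne
    finiteness
  intro ν h hh x
  set T : ℝ := (2:ℝ)^ν with hT
  have hT0 : 0 < T := by positivity
  have h1 : ∀ y, tlKer N ν x y * h y ≤ ∑' k : ℕ, ENNReal.ofReal (T^n * c k) *
      (ball x (2^k / T)).indicator h y := by
    intro y
    obtain ⟨k, hk1, hk2⟩ := tl_decay_dyadic hN0 (τ := T * ‖x - y‖) (by positivity)
    refine le_trans ?_ (ENNReal.le_tsum k)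
    have hy : y ∈ ball x (2^k/T) := by
      rw [mem_ball, dist_eq_norm, norm_sub_rev, lt_div_iff₀ hT0]
      linarith
    rw [indicator_of_mem hy]
    unfold tlKer
    gcongr
  calc tlAv N ν h x ≤ ∫⁻ y, ∑' k : ℕ, ENNReal.ofReal (T^n * c k) *
      (ball x (2^k / T)).indicator h y := lintegral_mono h1
    _ = ∑' k : ℕ, ENNReal.ofReal (T^n * c k) * ∫⁻ y in ball x (2^k/T), h y := by
        rw [lintegral_tsum]
        · congr 1
          funext k
          rw [lintegral_const_mul _ (hh.indicator measurableSet_ball),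
            lintegral_indicator measurableSet_ball]
        · intro k
          exact ((hh.indicator measurableSet_ball).const_mul _).aemeasurable
    _ ≤ ∑' k : ℕ, ENNReal.ofReal (T^n * c k) * (volume (ball x (2^k/T)) * tlMF h x) := by
        gcongr with k
        exact tl_ball_le_MF h x (by positivity)
    _ = _ := by
        rw [mul_assoc, ← ENNReal.tsum_mul_right]
        congr 1
        funext k
        rw [Measure.addHaar_ball_of_pos volume _ (by positivity), finrank_euclideanSpace_fin]
        rw [mul_assoc (ENNReal.ofReal ((2 ^ k / T) ^ n)), ← mul_assoc,
          ← ENNReal.ofReal_mul (by positivity)]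
        congr 2
        rw [div_pow]
        field_simp

lemma tl_Av_one {N : ℝ} (hN : (n:ℝ) < N) : ∃ C : ℝ≥0∞, C ≠ ∞ ∧ ∀ (ν : ℕ) (x : Rn n),
    volume.withDensity (tlKer N ν x) univ ≤ C := by
  obtain ⟨C, hC, hb⟩ := tl_Av_le_MF hN
  refine ⟨C, hC, fun ν x => ?_⟩
  have := hb ν (fun _ => 1) measurable_const x
  rw [tlAv_eq N ν measurable_const, lintegral_one] at this
  exact this.trans ((mul_le_mul_right (tl_MF_const 1 x) C).trans (mul_one C).le)

lemma tl_Av_jensen {N u : ℝ} (hN : (n:ℝ) < N) (hu : 1 < u) : ∃ C : ℝ≥0∞, C ≠ ∞ ∧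
    ∀ (ν : ℕ) (h : Rn n → ℝ≥0∞), Measurable h → ∀ x,
      tlAv N ν h x ^ u ≤ C * tlAv N ν (fun y => h y ^ u) x := by
  obtain ⟨C, hC, hb⟩ := tl_Av_one hN
  refine ⟨C ^ (u-1), ENNReal.rpow_ne_top_of_nonneg (by linarith) hC, fun ν h hh x => ?_⟩
  rw [tlAv_eq N ν hh, tlAv_eq N ν (hh.pow_const u)]
  refine (tl_jensen _ hu hh.aemeasurable).trans ?_
  gcongr
  exact hb ν x

lemma tl_Av_swap (N : ℝ) (ν : ℕ) {g h : Rn n → ℝ≥0∞} (hg : Measurable g) (hh : Measurable h) :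
    ∫⁻ x, tlAv N ν g x * h x = ∫⁻ x, g x * tlAv N ν h x := by
  unfold tlAv
  have hm : Measurable fun z : Rn n × Rn n => tlKer N ν z.1 z.2 := tlKer_measurable N ν
  calc _ = ∫⁻ x, ∫⁻ y, tlKer N ν x y * g y * h x := by
        refine lintegral_congr fun x => ?_
        rw [lintegral_mul_const _ ((tlKer_measurable_right N ν x).fun_mul hg)]
    _ = ∫⁻ y, ∫⁻ x, tlKer N ν x y * g y * h x := by
        rw [lintegral_lintegral_swap]
        exact ((hm.fun_mul (hg.comp measurable_snd)).fun_mul (hh.comp measurable_fst)).aemeasurable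
    _ = _ := by
        refine lintegral_congr fun y => ?_
        rw [← lintegral_const_mul _ ((tlKer_measurable_right N ν y).fun_mul hh)]
        refine lintegral_congr fun x => ?_
        rw [tlKer_symm N ν x y]
        ring

lemma tl_dual_ineq {N : ℝ} (hN : (n:ℝ) < N) : ∃ C : ℝ≥0∞, C ≠ ∞ ∧
    ∀ (g : ℕ → Rn n → ℝ≥0∞), (∀ ν, Measurable (g ν)) → ∀ h : Rn n → ℝ≥0∞, Measurable h →
      ∫⁻ x, (∑' ν, tlAv N ν (g ν) x) * h x ≤ C * ∫⁻ x, (∑' ν, g ν x) * tlMF h x := by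
  obtain ⟨C, hC, hb⟩ := tl_Av_le_MF hN
  refine ⟨C, hC, fun g hg h hh => ?_⟩
  have hM := tl_MF_measurable h
  simp_rw [← ENNReal.tsum_mul_right]
  rw [lintegral_tsum (fun ν => ((tlAv_measurable N ν (hg ν)).fun_mul hh).aemeasurable),
    lintegral_tsum (fun ν => ((hg ν).fun_mul hM).aemeasurable), ← ENNReal.tsum_mul_left]
  refine ENNReal.tsum_le_tsum fun ν => ?_
  rw [tl_Av_swap N ν (hg ν) hh, ← lintegral_const_mul _ ((hg ν).fun_mul hM)]
  refine lintegral_mono fun x => ?_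
  calc g ν x * tlAv N ν h x ≤ g ν x * (C * tlMF h x) := by gcongr; exact hb ν h hh x
    _ = _ := by ring

end TLAv

section TLVec

lemma tl_converse {t : ℝ} (ht : 1 < t) {F : Rn n → ℝ≥0∞} (hF : Measurable F) {D : ℝ≥0∞}
    (hD : ∀ h : Rn n → ℝ≥0∞, Measurable h →
      ∫⁻ x, F x * h x ≤ D * (∫⁻ x, h x ^ (t/(t-1))) ^ ((t-1)/t)) :
    ∫⁻ x, F x ^ t ≤ D ^ t := by
  have ht0 : 0 < t := by linarith
  have ht1 : 0 < t - 1 := by linarith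
  let Fk : ℕ → Rn n → ℝ≥0∞ := fun k => (closedBall 0 k).indicator fun x => min (F x) k
  have hFk : ∀ k, Measurable (Fk k) := fun k =>
    (hF.min measurable_const).indicator measurableSet_closedBall
  have hle : ∀ k x, Fk k x ≤ F x := by
    intro k x
    refine (indicator_le_self _ _ x).trans (min_le_left _ _)
  have hI : ∀ k, ∫⁻ x, Fk k x ^ t ≤ D ^ t := by
    intro k
    set I := ∫⁻ x, Fk k x ^ t with hIdef
    have hfin : I ≠ ∞ := by
      have h1 : I ≤ ∫⁻ x, (closedBall (0 : Rn n) k).indicator (fun _ => (k:ℝ≥0∞)^t) x := by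
        refine lintegral_mono fun x => ?_
        by_cases hx : x ∈ closedBall (0 : Rn n) k
        · simp only [Fk, indicator_of_mem hx]
          gcongr
          exact min_le_right _ _
        · simp only [Fk, indicator_of_notMem hx]
          rw [ENNReal.zero_rpow_of_pos ht0]
      rw [lintegral_indicator measurableSet_closedBall, setLIntegral_const] at h1
      refine ne_top_of_le_ne_top ?_ h1
      have h2 : (k:ℝ≥0∞)^t ≠ ∞ := ENNReal.rpow_ne_top_of_nonneg ht0.le (by simp)
      have h3 : volume (closedBall (0 : Rn n) k) ≠ ∞ := measure_closedBall_lt_top.ne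
      finiteness
    have h1 := hD (fun x => Fk k x ^ (t-1)) ((hFk k).pow_const _)
    have h2 : ∫⁻ x, (Fk k x ^ (t-1)) ^ (t/(t-1)) = I := by
      refine lintegral_congr fun x => ?_
      rw [← ENNReal.rpow_mul]
      congr 1
      field_simp
    rw [h2] at h1
    have h3 : I ≤ ∫⁻ x, F x * Fk k x ^ (t-1) := by
      refine lintegral_mono fun x => ?_
      calc Fk k x ^ t = Fk k x ^ (1:ℝ) * Fk k x ^ (t-1) := by
            rw [← ENNReal.rpow_add_of_nonneg _ _ (by norm_num) ht1.le]
            congr 1; ring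
        _ ≤ _ := by
            rw [ENNReal.rpow_one]
            gcongr
            exact hle k x
    have h4 := h3.trans h1
    rcases eq_or_ne I 0 with h0 | h0
    · rw [h0]; exact zero_le
    have h5 : I ^ (1/t) ≤ D := by
      have h6 : I ^ (1/t) * I ^ ((t-1)/t) = I := by
        rw [← ENNReal.rpow_add _ _ h0 hfin]
        rw [show 1/t + (t-1)/t = 1 by field_simp; ring, ENNReal.rpow_one]
      rw [← h6] at h4
      have h7 : I ^ ((t-1)/t) ≠ 0 := by
        simp [ENNReal.rpow_eq_zero_iff, h0, hfin]
      have h8 : I ^ ((t-1)/t) ≠ ∞ := ENNReal.rpow_ne_top_of_nonneg (by positivity) hfin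
      rw [h6] at h4
      have h9 : I ^ (1/t) * I ^ ((t-1)/t) ≤ D * I ^ ((t-1)/t) := by rw [h6]; exact h4
      exact (ENNReal.mul_le_mul_iff_left h7 h8).1 h9
    calc I = (I ^ (1/t)) ^ t := by
          rw [← ENNReal.rpow_mul, show 1/t*t = 1 by field_simp, ENNReal.rpow_one]
      _ ≤ _ := by gcongr
  have htend : Tendsto (fun k => ∫⁻ x, Fk k x ^ t) atTop (𝓝 (∫⁻ x, F x ^ t)) := by
    refine lintegral_tendsto_of_tendsto_of_monotone (fun k => ((hFk k).pow_const t).aemeasurable)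
      (Eventually.of_forall fun x => ?_) (Eventually.of_forall fun x => ?_)
    · intro k l hkl
      simp only
      gcongr
      have hkl' : (k:ℝ) ≤ l := by exact_mod_cast hkl
      by_cases hx : x ∈ closedBall (0 : Rn n) k
      · have hx' : x ∈ closedBall (0 : Rn n) l := closedBall_subset_closedBall hkl' hx
        simp only [Fk, indicator_of_mem hx, indicator_of_mem hx']
        gcongr
      · simp only [Fk, indicator_of_notMem hx]
        exact zero_le
    · have h1 : Tendsto (fun k : ℕ => min (F x) (k:ℝ≥0∞)) atTop (𝓝 (min (F x) ∞)) :=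
        tendsto_const_nhds.min ENNReal.tendsto_nat_nhds_top
      rw [min_eq_left le_top] at h1
      have h2 := ((ENNReal.continuous_rpow_const (y := t)).tendsto (F x)).comp h1
      refine h2.congr' ?_
      obtain ⟨K, hK⟩ := exists_nat_ge ‖x‖
      filter_upwards [eventually_ge_atTop K] with k hk
      have hx : x ∈ closedBall (0 : Rn n) k := by
        simp only [mem_closedBall, dist_zero_right]
        exact hK.trans (by exact_mod_cast hk)
      simp only [Fk, indicator_of_mem hx, Function.comp]
  exact le_of_tendsto' htend hI

lemma tl_V_eq {N : ℝ} (hN : (n:ℝ) < N) {u : ℝ} (hu : 1 < u) : ∃ C : ℝ≥0∞, C ≠ ∞ ∧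
    ∀ g : ℕ → Rn n → ℝ≥0∞, (∀ ν, Measurable (g ν)) →
      ∀ h : Rn n → ℝ≥0∞, Measurable h →
      ∫⁻ x, (∑' ν, tlAv N ν (g ν) x ^ u) * h x ≤ C * ∫⁻ x, (∑' ν, g ν x ^ u) * tlMF h x := by
  obtain ⟨C1, hC1, h1⟩ := tl_Av_jensen hN hu
  obtain ⟨C2, hC2, h2⟩ := tl_dual_ineq hN
  refine ⟨C1 * C2, by finiteness, fun g hg h hh => ?_⟩
  calc _ ≤ ∫⁻ x, C1 * ((∑' ν, tlAv N ν (fun y => g ν y ^ u) x) * h x) := by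
        refine lintegral_mono fun x => ?_
        simp only
        rw [← mul_assoc, ← ENNReal.tsum_mul_left]
        gcongr with ν
        exact h1 ν (g ν) (hg ν) x
    _ = C1 * ∫⁻ x, (∑' ν, tlAv N ν (fun y => g ν y ^ u) x) * h x := lintegral_const_mul' _ _ hC1
    _ ≤ _ := by
        rw [mul_assoc]
        gcongr
        exact h2 _ (fun ν => (hg ν).pow_const u) h hh

lemma tl_V_lt {N : ℝ} (hN : (n:ℝ) < N) {u r : ℝ} (hu : 1 < u) (hur : u < r) :
    ∃ C : ℝ≥0∞, C ≠ ∞ ∧ ∀ g : ℕ → Rn n → ℝ≥0∞, (∀ ν, Measurable (g ν)) →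
      ∫⁻ x, (∑' ν, tlAv N ν (g ν) x ^ u) ^ (r/u) ≤ C * ∫⁻ x, (∑' ν, g ν x ^ u) ^ (r/u) := by
  obtain ⟨C1, hC1, h1⟩ := tl_V_eq hN hu
  have hu0 : 0 < u := by linarith
  set t := r/u with htdef
  have ht : 1 < t := (one_lt_div hu0).2 hur
  have ht0 : 0 < t := by linarith
  have ht1 : 0 < t - 1 := by linarith
  have ht' : 1 < t/(t-1) := (one_lt_div ht1).2 (by linarith)
  obtain ⟨C2, hC2, h2⟩ := tl_strong (n := n) ht'
  refine ⟨(C1 * C2 ^ ((t-1)/t)) ^ t, ?_, fun g hg => ?_⟩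
  · have : C2 ^ ((t-1)/t) ≠ ∞ := ENNReal.rpow_ne_top_of_nonneg (by positivity) hC2
    exact ENNReal.rpow_ne_top_of_nonneg ht0.le (by finiteness)
  have hH : Measurable fun x => ∑' ν, g ν x ^ u := Measurable.tsum fun ν => (hg ν).pow_const u
  have hF : Measurable fun x => ∑' ν, tlAv N ν (g ν) x ^ u :=
    Measurable.tsum fun ν => (tlAv_measurable N ν (hg ν)).pow_const u
  set I := ∫⁻ x, (∑' ν, g ν x ^ u) ^ t with hI
  have key : ∀ h : Rn n → ℝ≥0∞, Measurable h → ∫⁻ x, (∑' ν, tlAv N ν (g ν) x ^ u) * h x ≤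
      (C1 * C2 ^ ((t-1)/t) * I ^ (1/t)) * (∫⁻ x, h x ^ (t/(t-1))) ^ ((t-1)/t) := by
    intro h hh
    refine (h1 g hg h hh).trans ?_
    have hpq : t.HolderConjugate (t/(t-1)) := Real.HolderConjugate.conjExponent ht
    have h3 := ENNReal.lintegral_mul_le_Lp_mul_Lq volume hpq hH.aemeasurable
      (tl_MF_measurable h).aemeasurable
    simp only [Pi.mul_apply] at h3
    rw [one_div_div t (t-1)] at h3
    calc _ ≤ C1 * (I ^ (1/t) * (C2 * ∫⁻ x, h x ^ (t/(t-1))) ^ ((t-1)/t)) := by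
          refine mul_le_mul_right (h3.trans ?_) _
          exact mul_le_mul_right (ENNReal.rpow_le_rpow (h2 h hh) (by positivity)) _
      _ = _ := by
          rw [ENNReal.mul_rpow_of_nonneg _ _ (by positivity)]
          ring
  refine (tl_converse ht hF key).trans ?_
  rw [ENNReal.mul_rpow_of_nonneg _ _ ht0.le, ← ENNReal.rpow_mul, show 1/t*t = 1 by field_simp,
    ENNReal.rpow_one]

lemma tl_V_gt {N : ℝ} (hN : (n:ℝ) < N) {u r : ℝ} (hr : 1 < r) (hur : r < u) :
    ∃ C : ℝ≥0∞, C ≠ ∞ ∧ ∀ g : ℕ → Rn n → ℝ≥0∞, (∀ ν, Measurable (g ν)) →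
      ∫⁻ x, (∑' ν, tlAv N ν (g ν) x ^ u) ^ (r/u) ≤ C * ∫⁻ x, (∑' ν, g ν x ^ u) ^ (r/u) := by
  have hu : 1 < u := by linarith
  have hu0 : 0 < u := by linarith
  have hu1 : 0 < u - 1 := by linarith
  have hr0 : 0 < r := by linarith
  have hur' : 0 < u - r := by linarith
  obtain ⟨C1, hC1, h1⟩ := tl_Av_le_MF hN
  obtain ⟨C2, hC2, h2⟩ := tl_dual_ineq hN
  have hγ : 1 < r * (u-1) / (u-r) := by
    rw [one_lt_div hur']; nlinarith
  obtain ⟨C3, hC3, h3⟩ := tl_strong (n := n) hγ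
  refine ⟨(C1 ^ (u-1)) ^ (r/u) * C2 ^ (r/u) * C3 ^ ((u-r)/u) + 1, ?_, fun g hg => ?_⟩
  · have e1 : (C1 ^ (u-1)) ^ (r/u) ≠ ∞ := ENNReal.rpow_ne_top_of_nonneg (by positivity)
      (ENNReal.rpow_ne_top_of_nonneg hu1.le hC1)
    have e2 : C2 ^ (r/u) ≠ ∞ := ENNReal.rpow_ne_top_of_nonneg (by positivity) hC2
    have e3 : C3 ^ ((u-r)/u) ≠ ∞ := ENNReal.rpow_ne_top_of_nonneg (by positivity) hC3
    finiteness
  set H : Rn n → ℝ≥0∞ := fun x => ∑' ν, g ν x ^ u with hHdef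
  have hH : Measurable H := Measurable.tsum fun ν => (hg ν).pow_const u
  change _ ≤ _ * ∫⁻ x, H x ^ (r/u)
  set I := ∫⁻ x, H x ^ (r/u) with hI
  rcases eq_or_ne I ∞ with hItop | hIfin
  · rw [hItop, ENNReal.mul_top (by simp)]
    exact le_top
  have hae : ∀ᵐ x : Rn n, H x ≠ ∞ := by
    filter_upwards [ae_lt_top (hH.pow_const _) hIfin] with x hx hx2
    rw [hx2, ENNReal.top_rpow_of_pos (by positivity)] at hx
    exact lt_irrefl _ hx
  have hH0 : ∀ x ν, H x = 0 → g ν x = 0 := by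
    intro x ν hx
    have h4 := ENNReal.tsum_eq_zero.1 hx ν
    rcases ENNReal.rpow_eq_zero_iff.1 h4 with h5 | h5
    · exact h5.1
    · linarith [h5.2]
  set P : Rn n → ℝ≥0∞ := fun x => H x ^ ((u-r)/(u*(u-1))) with hPdef
  have hP : Measurable P := hH.pow_const _
  set W : Rn n → ℝ≥0∞ := tlMF P with hWdef
  have hW : Measurable W := tl_MF_measurable P
  set G : ℕ → Rn n → ℝ≥0∞ := fun ν x => (g ν x * H x ^ (-((u-r)/u^2))) ^ u with hGdef
  have hG : ∀ ν, Measurable (G ν) := fun ν => ((hg ν).mul (hH.pow_const _)).pow_const u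
  have step1 : ∀ ν x, tlAv N ν (g ν) x ^ u ≤ tlAv N ν (G ν) x * (C1 * W x) ^ (u-1) := by
    intro ν x
    rw [tlAv_eq N ν (hg ν), tlAv_eq N ν (hG ν)]
    set μ := (volume : Measure (Rn n)).withDensity (tlKer N ν x) with hμ
    have h5 : ∫⁻ y, g ν y ∂μ ≤ ∫⁻ y, (g ν y * H y ^ (-((u-r)/u^2))) * H y ^ ((u-r)/u^2) ∂μ := by
      refine lintegral_mono_ae ?_
      have : ∀ᵐ y ∂μ, H y ≠ ∞ := (withDensity_absolutelyContinuous _ _).ae_le hae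
      filter_upwards [this] with y hy
      rcases eq_or_ne (H y) 0 with h0 | h0
      · rw [hH0 y ν h0]; exact zero_le
      · rw [mul_assoc, ← ENNReal.rpow_add _ _ h0 hy, neg_add_cancel, ENNReal.rpow_zero, mul_one]
    have h6 := tl_holder μ hu (f := fun y => g ν y * H y ^ (-((u-r)/u^2)))
      (g := fun y => H y ^ ((u-r)/u^2)) ((hg ν).mul (hH.pow_const _)).aemeasurable
      (hH.pow_const _).aemeasurable
    calc _ ≤ _ := ENNReal.rpow_le_rpow h5 hu0.le
      _ ≤ _ := h6
      _ ≤ _ := by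
        gcongr
        have h7 := h1 ν P hP x
        rw [tlAv_eq N ν hP, ← hμ] at h7
        refine le_trans (le_of_eq ?_) h7
        refine lintegral_congr fun y => ?_
        simp only [hPdef]
        rw [← ENNReal.rpow_mul]
        congr 1
        field_simp
  set S : Rn n → ℝ≥0∞ := fun x => ∑' ν, tlAv N ν (G ν) x with hSdef
  have hS : Measurable S := Measurable.tsum fun ν => tlAv_measurable N ν (hG ν)
  have hSI : ∫⁻ x, S x ≤ C2 * I := by
    have h4 := h2 G hG (fun _ => 1) measurable_const
    simp only [mul_one] at h4
    refine h4.trans ?_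
    gcongr
    refine lintegral_mono_ae ?_
    filter_upwards [hae] with x hx
    calc _ ≤ (∑' ν, G ν x) * 1 := by gcongr; exact tl_MF_const 1 x
      _ = H x * (H x ^ (-((u-r)/u^2))) ^ u := by
        rw [mul_one, hHdef]
        simp only
        rw [← ENNReal.tsum_mul_right]
        congr 1
        funext ν
        simp only [hGdef]
        rw [ENNReal.mul_rpow_of_nonneg _ _ hu0.le]
      _ ≤ H x ^ (r/u) := by
        rcases eq_or_ne (H x) 0 with h0 | h0
        · rw [h0, zero_mul]; exact zero_le
        · rw [← ENNReal.rpow_mul]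
          nth_rewrite 1 [← ENNReal.rpow_one (H x)]
          rw [← ENNReal.rpow_add _ _ h0 hx]
          apply le_of_eq
          congr 1
          field_simp
          ring
  have hWI : ∫⁻ x, W x ^ (r*(u-1)/(u-r)) ≤ C3 * I := by
    refine (h3 P hP).trans (le_of_eq ?_)
    congr 1
    refine lintegral_congr fun x => ?_
    simp only [hPdef]
    rw [← ENNReal.rpow_mul]
    congr 1
    field_simp
  have hv : 1 < u/r := (one_lt_div hr0).2 hur
  have hpq : (u/r).HolderConjugate (u/(u-r)) := by
    have := Real.HolderConjugate.conjExponent hv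
    have e : u/r/(u/r-1) = u/(u-r) := by field_simp
    rw [Real.conjExponent, e] at this
    exact this
  have hHol := ENNReal.lintegral_mul_le_Lp_mul_Lq volume hpq (f := fun x => S x ^ (r/u))
    (g := fun x => W x ^ ((u-1)*(r/u))) (hS.pow_const _).aemeasurable (hW.pow_const _).aemeasurable
  have hfin : ∫⁻ x, S x ^ (r/u) * W x ^ ((u-1)*(r/u)) ≤
      C2 ^ (r/u) * C3 ^ ((u-r)/u) * I := by
    refine hHol.trans ?_
    have e1 : ∫⁻ x, (S x ^ (r/u)) ^ (u/r) = ∫⁻ x, S x := by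
      refine lintegral_congr fun x => ?_
      rw [← ENNReal.rpow_mul, show r/u*(u/r) = 1 by field_simp, ENNReal.rpow_one]
    have e2 : ∫⁻ x, (W x ^ ((u-1)*(r/u))) ^ (u/(u-r)) = ∫⁻ x, W x ^ (r*(u-1)/(u-r)) := by
      refine lintegral_congr fun x => ?_
      rw [← ENNReal.rpow_mul]
      congr 1
      field_simp
    rw [e1, e2, one_div_div, one_div_div]
    calc _ ≤ (C2 * I) ^ (r/u) * (C3 * I) ^ ((u-r)/u) := by gcongr
      _ = C2 ^ (r/u) * C3 ^ ((u-r)/u) * (I ^ (r/u) * I ^ ((u-r)/u)) := by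
        rw [ENNReal.mul_rpow_of_nonneg _ _ (by positivity),
          ENNReal.mul_rpow_of_nonneg _ _ (by positivity)]
        ring
      _ = _ := by
        rw [← ENNReal.rpow_add_of_nonneg _ _ (by positivity) (by positivity),
          show r/u + (u-r)/u = 1 by field_simp; ring, ENNReal.rpow_one]
  calc _ ≤ ∫⁻ x, (C1 ^ (u-1)) ^ (r/u) * (S x ^ (r/u) * W x ^ ((u-1)*(r/u))) := by
        refine lintegral_mono fun x => ?_
        have h7 : ∑' ν, tlAv N ν (g ν) x ^ u ≤ S x * (C1 * W x) ^ (u-1) := by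
          simp only [hSdef]
          rw [← ENNReal.tsum_mul_right]
          exact ENNReal.tsum_le_tsum fun ν => step1 ν x
        calc _ ≤ (S x * (C1 * W x) ^ (u-1)) ^ (r/u) := ENNReal.rpow_le_rpow h7 (by positivity)
          _ = _ := by
            rw [ENNReal.mul_rpow_of_nonneg _ _ hu1.le, ENNReal.mul_rpow_of_nonneg _ _ (by positivity),
              ENNReal.mul_rpow_of_nonneg _ _ (by positivity), ENNReal.rpow_mul (W x)]
            ring
    _ = (C1 ^ (u-1)) ^ (r/u) * ∫⁻ x, S x ^ (r/u) * W x ^ ((u-1)*(r/u)) :=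
        lintegral_const_mul _ ((hS.pow_const _).mul (hW.pow_const _))
    _ ≤ (C1 ^ (u-1)) ^ (r/u) * (C2 ^ (r/u) * C3 ^ ((u-r)/u) * I) := by gcongr
    _ ≤ _ := by
        rw [← mul_assoc, ← mul_assoc]
        gcongr
        exact le_self_add

lemma tl_V {N : ℝ} (hN : (n:ℝ) < N) {u r : ℝ} (hu : 1 < u) (hr : 1 < r) :
    ∃ C : ℝ≥0∞, C ≠ ∞ ∧ ∀ g : ℕ → Rn n → ℝ≥0∞, (∀ ν, Measurable (g ν)) →
      ∫⁻ x, (∑' ν, tlAv N ν (g ν) x ^ u) ^ (r/u) ≤ C * ∫⁻ x, (∑' ν, g ν x ^ u) ^ (r/u) := by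
  rcases lt_trichotomy u r with h | h | h
  · exact tl_V_lt hN hu h
  · subst h
    obtain ⟨C, hC, hb⟩ := tl_V_eq hN hu
    refine ⟨C, hC, fun g hg => ?_⟩
    have h1 := hb g hg (fun _ => 1) measurable_const
    rw [div_self (by linarith)]
    simp only [mul_one, ENNReal.rpow_one] at h1 ⊢
    refine h1.trans ?_
    gcongr with x
    exact (mul_le_mul_right (tl_MF_const 1 x) _).trans (mul_one _).le
  · exact tl_V_gt hN hr h

lemma tl_V_top {N : ℝ} (hN : (n:ℝ) < N) {r : ℝ} (hr : 1 < r) :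
    ∃ C : ℝ≥0∞, C ≠ ∞ ∧ ∀ g : ℕ → Rn n → ℝ≥0∞, (∀ ν, Measurable (g ν)) →
      ∫⁻ x, (⨆ ν, tlAv N ν (g ν) x) ^ r ≤ C * ∫⁻ x, (⨆ ν, g ν x) ^ r := by
  obtain ⟨C1, hC1, h1⟩ := tl_Av_le_MF hN
  obtain ⟨C2, hC2, h2⟩ := tl_strong (n := n) hr
  have hr0 : 0 ≤ r := by linarith
  have e1 : C1 ^ r ≠ ∞ := ENNReal.rpow_ne_top_of_nonneg hr0 hC1
  refine ⟨C1 ^ r * C2, by finiteness, fun g hg => ?_⟩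
  have hm : Measurable fun x => ⨆ ν, g ν x := Measurable.iSup hg
  calc _ ≤ ∫⁻ x, C1 ^ r * (tlMF (fun y => ⨆ ν, g ν y) x) ^ r := by
        refine lintegral_mono fun x => ?_
        simp only
        rw [← ENNReal.mul_rpow_of_nonneg _ _ hr0]
        gcongr
        refine iSup_le fun ν => ?_
        refine (h1 ν (g ν) (hg ν) x).trans ?_
        exact mul_le_mul_right (tl_MF_mono (fun y => le_iSup (fun ν => g ν y) ν) x) _
    _ = C1 ^ r * ∫⁻ x, (tlMF (fun y => ⨆ ν, g ν y) x) ^ r := lintegral_const_mul' _ _ e1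
    _ ≤ _ := by
        rw [mul_assoc]
        exact mul_le_mul_right (h2 _ hm) _

end TLVec

section TLSeq

lemma tl_tsum_rpow {ι : Type*} (f : ι → ℝ≥0∞) {w : ℝ} (hw : 0 < w) (hw1 : w ≤ 1) :
    (∑' i, f i) ^ w ≤ ∑' i, f i ^ w := by
  have hfin : ∀ S : Finset ι, (∑ i ∈ S, f i) ^ w ≤ ∑ i ∈ S, f i ^ w := by
    classical
    intro S
    induction S using Finset.induction_on with
    | empty => simp [ENNReal.zero_rpow_of_pos hw]
    | insert i S hi ih =>
      rw [Finset.sum_insert hi, Finset.sum_insert hi]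
      exact (ENNReal.rpow_add_le_add_rpow _ _ hw.le hw1).trans (add_le_add le_rfl ih)
  have ht : Tendsto (fun S : Finset ι => (∑ i ∈ S, f i) ^ w) atTop (𝓝 ((∑' i, f i) ^ w)) :=
    ((ENNReal.continuous_rpow_const (y := w)).tendsto _).comp ENNReal.summable.hasSum
  exact le_of_tendsto' ht fun S => (hfin S).trans (ENNReal.sum_le_tsum S)

def tlBall (ν : ℕ) (m : Fin n → ℤ) : Set (Rn n) := ball (((2:ℝ)^ν)⁻¹ • zpt m) (((2:ℝ)^ν)⁻¹ / 2)

lemma tlBall_coord {ν : ℕ} {m : Fin n → ℤ} {y : Rn n} (hy : y ∈ tlBall ν m) (i : Fin n) :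
    |y i - ((2:ℝ)^ν)⁻¹ * (m i : ℝ)| < ((2:ℝ)^ν)⁻¹ / 2 := by
  have h1 : ‖y - ((2:ℝ)^ν)⁻¹ • zpt m‖ < ((2:ℝ)^ν)⁻¹ / 2 := by
    simpa [tlBall, dist_eq_norm] using hy
  have h2 := PiLp.norm_apply_le (y - ((2:ℝ)^ν)⁻¹ • zpt m) i
  have h3 : (y - ((2:ℝ)^ν)⁻¹ • zpt m) i = y i - ((2:ℝ)^ν)⁻¹ * (m i : ℝ) := by
    simp [zpt]
  rw [h3, Real.norm_eq_abs] at h2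
  linarith

lemma tlBall_sub (ν : ℕ) (m : Fin n → ℤ) : tlBall ν m ⊆ dQ 1 ν m := by
  intro y hy i
  have h := tlBall_coord hy i
  rw [Real.rpow_neg (by norm_num), Real.rpow_natCast, one_mul]
  exact h.le

lemma tlBall_disj (ν : ℕ) : Pairwise (Function.onFun Disjoint (tlBall (n := n) ν)) := by
  intro m m' hmm
  rw [Function.onFun, Set.disjoint_left]
  intro y h1 h2
  apply hmm
  funext i
  have a1 := abs_lt.1 (tlBall_coord h1 i)
  have a2 := abs_lt.1 (tlBall_coord h2 i)
  have hT : (0:ℝ) < ((2:ℝ)^ν)⁻¹ := by positivity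
  have b1 : ((2:ℝ)^ν)⁻¹ * ((m i : ℝ) - m' i) < ((2:ℝ)^ν)⁻¹ * 1 := by linarith [a1.1, a1.2, a2.1, a2.2]
  have b2 : ((2:ℝ)^ν)⁻¹ * ((m' i : ℝ) - m i) < ((2:ℝ)^ν)⁻¹ * 1 := by linarith [a1.1, a1.2, a2.1, a2.2]
  have c1 := lt_of_mul_lt_mul_left b1 hT.le
  have c2 := lt_of_mul_lt_mul_left b2 hT.le
  have d1 : m i - m' i < 1 := by exact_mod_cast c1
  have d2 : m' i - m i < 1 := by exact_mod_cast c2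
  omega

lemma tlBall_vol (ν : ℕ) (m : Fin n → ℤ) :
    volume (tlBall ν m) = ENNReal.ofReal ((((2:ℝ)^ν)⁻¹ / 2) ^ n) * volume (ball (0 : Rn n) 1) := by
  unfold tlBall
  rw [Measure.addHaar_ball_of_pos volume _ (by positivity)]
  simp

lemma tl_b_le {N : ℝ} (hN : 0 ≤ N) : ∃ C : ℝ≥0∞, C ≠ ∞ ∧ ∀ (ν : ℕ) (μ : (Fin n → ℤ) → ℝ≥0∞)
    (G : Rn n → ℝ≥0∞) (_ : ∀ m, ∀ y ∈ dQ 1 ν m, μ m ≤ G y) (x : Rn n),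
    ∑' m, μ m * ENNReal.ofReal ((1 + ‖(2:ℝ)^ν • x - zpt m‖) ^ (-N)) ≤ C * tlAv N ν G x := by
  set D : ℝ≥0∞ := ENNReal.ofReal ((3/2:ℝ)^(-N) * (1/2:ℝ)^n) * volume (ball (0 : Rn n) 1) with hD
  have hD0 : D ≠ 0 := by
    refine mul_ne_zero ?_ ?_
    · rw [Ne, ENNReal.ofReal_eq_zero, not_le]; positivity
    · exact (measure_ball_pos volume _ one_pos).ne'
  have hDt : D ≠ ∞ := ENNReal.mul_ne_top ENNReal.ofReal_ne_top measure_ball_lt_top.ne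
  refine ⟨D⁻¹, ENNReal.inv_ne_top.2 hD0, fun ν μ G hG x => ?_⟩
  suffices h : D * ∑' m, μ m * ENNReal.ofReal ((1 + ‖(2:ℝ)^ν • x - zpt m‖) ^ (-N)) ≤ tlAv N ν G x by
    calc _ = D⁻¹ * (D * ∑' m, μ m * ENNReal.ofReal ((1 + ‖(2:ℝ)^ν • x - zpt m‖) ^ (-N))) := by
          rw [← mul_assoc, ENNReal.inv_mul_cancel hD0 hDt, one_mul]
      _ ≤ _ := mul_le_mul_right h _
  have hT : (0:ℝ) < (2:ℝ)^ν := by positivity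
  have hb : ∀ m, ∀ y ∈ tlBall ν m, ENNReal.ofReal (((2:ℝ)^ν)^n * ((3/2:ℝ)^(-N) *
      (1 + ‖(2:ℝ)^ν • x - zpt m‖) ^ (-N))) * μ m ≤ tlKer N ν x y * G y := by
    intro m y hy
    refine mul_le_mul' ?_ (hG m y (tlBall_sub ν m hy))
    unfold tlKer
    refine ENNReal.ofReal_le_ofReal ?_
    refine mul_le_mul_of_nonneg_left ?_ (by positivity)
    rw [← Real.mul_rpow (by norm_num) (by positivity)]
    refine Real.rpow_le_rpow_of_nonpos (by positivity) ?_ (by linarith)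
    have h1 : ‖y - ((2:ℝ)^ν)⁻¹ • zpt m‖ < ((2:ℝ)^ν)⁻¹ / 2 := by
      simpa [tlBall, dist_eq_norm] using hy
    have h2 : (2:ℝ)^ν • (x - y) = ((2:ℝ)^ν • x - zpt m) - (2:ℝ)^ν • (y - ((2:ℝ)^ν)⁻¹ • zpt m) := by
      rw [smul_sub, smul_sub, smul_smul, mul_inv_cancel₀ hT.ne', one_smul]
      abel
    have h3 : (2:ℝ)^ν * ‖x - y‖ ≤ ‖(2:ℝ)^ν • x - zpt m‖ + (2:ℝ)^ν * ‖y - ((2:ℝ)^ν)⁻¹ • zpt m‖ := by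
      have h4 := norm_sub_le ((2:ℝ)^ν • x - zpt m) ((2:ℝ)^ν • (y - ((2:ℝ)^ν)⁻¹ • zpt m))
      rw [← h2, norm_smul, norm_smul, Real.norm_of_nonneg hT.le] at h4
      exact h4
    have h5 : (2:ℝ)^ν * ‖y - ((2:ℝ)^ν)⁻¹ • zpt m‖ ≤ 1/2 := by
      calc _ ≤ (2:ℝ)^ν * (((2:ℝ)^ν)⁻¹ / 2) := by gcongr
        _ = 1/2 := by field_simp
    have h6 := norm_nonneg ((2:ℝ)^ν • x - zpt m)
    linarith
  have hm : ∀ m, MeasurableSet (tlBall (n := n) ν m) := fun m => measurableSet_ball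
  calc _ = ∑' m, D * (μ m * ENNReal.ofReal ((1 + ‖(2:ℝ)^ν • x - zpt m‖) ^ (-N))) := by
        rw [ENNReal.tsum_mul_left]
    _ ≤ ∑' m, ∫⁻ y in tlBall ν m, tlKer N ν x y * G y := by
        refine ENNReal.tsum_le_tsum fun m => ?_
        refine le_trans ?_ (setLIntegral_mono' (hm m) (hb m))
        rw [setLIntegral_const, tlBall_vol, hD]
        have e : ENNReal.ofReal (((2:ℝ)^ν)^n * ((3/2:ℝ)^(-N) *
            (1 + ‖(2:ℝ)^ν • x - zpt m‖) ^ (-N))) * ENNReal.ofReal ((((2:ℝ)^ν)⁻¹ / 2) ^ n) =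
            ENNReal.ofReal ((3/2:ℝ)^(-N) * (1/2:ℝ)^n) *
              ENNReal.ofReal ((1 + ‖(2:ℝ)^ν • x - zpt m‖) ^ (-N)) := by
          rw [← ENNReal.ofReal_mul (by positivity), ← ENNReal.ofReal_mul (by positivity)]
          congr 1
          have : (((2:ℝ)^ν)⁻¹ / 2) ^ n = (((2:ℝ)^ν)^n)⁻¹ * (1/2)^n := by
            rw [div_eq_mul_one_div, mul_pow, inv_pow]
          rw [this]
          have h7 : ((2:ℝ)^ν)^n ≠ 0 := by positivity
          field_simp
        refine le_of_eq ?_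
        calc _ = (ENNReal.ofReal ((3/2:ℝ)^(-N) * (1/2:ℝ)^n) *
              ENNReal.ofReal ((1 + ‖(2:ℝ)^ν • x - zpt m‖) ^ (-N))) * (μ m * volume (ball (0 : Rn n) 1)) := by
                ring
          _ = _ := by rw [← e]; ring
    _ = ∫⁻ y in ⋃ m, tlBall ν m, tlKer N ν x y * G y := (lintegral_iUnion hm (tlBall_disj ν) _).symm
    _ ≤ _ := setLIntegral_le_lintegral _ _

end TLSeq

section TLFinal

def tlG (w : ℝ) (p : ℝ≥0∞) (lam : ℕ → (Fin n → ℤ) → ℂ) (ν : ℕ) (y : Rn n) : ℝ≥0∞ :=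
  ⨆ m, ((‖lam ν m‖₊ : ℝ≥0∞) * chiP p ν m y) ^ w

lemma tl_dQ_meas (d : ℝ) (ν : ℕ) (m : Fin n → ℤ) : MeasurableSet (dQ d ν m) := by
  apply IsClosed.measurableSet
  have : dQ d ν m = ⋂ i, {x : Rn n | |x i - 2 ^ (-(ν : ℝ)) * (m i : ℝ)| ≤ d * 2 ^ (-(ν : ℝ)) / 2} := by
    ext x
    simp [dQ]
  rw [this]
  exact isClosed_iInter fun i => isClosed_le (by fun_prop) (by fun_prop)

lemma tlG_meas (w : ℝ) (p : ℝ≥0∞) (lam : ℕ → (Fin n → ℤ) → ℂ) (ν : ℕ) :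
    Measurable (tlG w p lam ν) := by
  unfold tlG
  refine Measurable.iSup fun m => Measurable.pow_const (Measurable.const_mul ?_ _) _
  unfold chiP
  exact Measurable.ite (tl_dQ_meas 1 ν m) measurable_const measurable_const

lemma tl_two (r : ℝ) : ENNReal.ofReal ((2:ℝ) ^ r) = (2:ℝ≥0∞) ^ r := by
  rw [← ENNReal.ofReal_rpow_of_pos (by norm_num)]
  norm_num

lemma tl_ptwise [CompleteSpace E] {φ : ℕ → Sch n} (hφ : SmoothResolution n φ) {s : ℝ} {p : ℝ≥0∞}
    {K : ℕ} {L : ℤ} {d : ℝ} (hd : 1 < d) (hL : -1 ≤ L) (hK : s < K) {M : ℝ} (hM0 : 0 ≤ M)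
    (hM : M < L + 1 + n + s) {w : ℝ} (hw : 0 < w) (hw1 : w ≤ 1) :
    ∃ δ > (0:ℝ), ∃ C : ℝ≥0∞, C ≠ ∞ ∧ ∀ (f : TDist n E) (lam : ℕ → (Fin n → ℤ) → ℂ)
        (a : ℕ → (Fin n → ℤ) → Rn n → E),
      (∀ m, Is1Atom K d m (a 0 m)) →
      (∀ ν m, 0 < ν → IsSPAtom s p K L d ν m (a ν m)) →
      RepresentsAtomic f lam a → ∀ (j : ℕ) (x : Rn n),
      ((2 : ℝ≥0∞) ^ ((j : ℝ) * s) * (‖mOp (φ j) f x‖₊ : ℝ≥0∞)) ^ w ≤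
        C * ∑' ν : ℕ, ENNReal.ofReal ((2:ℝ) ^ (-δ * |(j:ℝ) - ν|)) * tlAv (M * w) ν (tlG w p lam ν) x := by
  obtain ⟨ε, hε, C0, hC0, H⟩ := tl_atom_est (E := E) (p := p) hφ hd hL hK hM0 hM
  obtain ⟨C1, hC1, H1⟩ := tl_b_le (n := n) (N := M * w) (by positivity)
  set c0 : ℝ := (2 * π) ^ (-(n : ℝ) / 2) with hc0
  have hc0p : 0 ≤ c0 := by positivity
  set D : ℝ≥0∞ := ENNReal.ofReal (c0 * C0) with hD
  refine ⟨ε * w, by positivity, D ^ w * C1, ENNReal.mul_ne_top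
    (ENNReal.rpow_ne_top_of_nonneg hw.le ENNReal.ofReal_ne_top) hC1, ?_⟩
  intro f lam a ha0 ha1 hrep j x
  have hat : ∀ ν m, (2:ℝ) ^ ((j:ℝ) * s) * ‖∫ y, shiftReflect (invFourierS (φ j)) x y • a ν m y‖ ≤
        C0 * (2:ℝ) ^ (-ε * |(j:ℝ) - ν|) * ((2:ℝ) ^ ((ν:ℝ) * n / p.toReal) *
          (1 + ‖(2:ℝ)^ν • x - zpt m‖) ^ (-M)) := by
    intro ν m
    refine H j ν m (a ν m) ?_ (ha1 ν m) x
    rintro rfl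
    exact ha0 m
  set ψ := shiftReflect (invFourierS (φ j)) x with hψ
  set Z : ℕ × (Fin n → ℤ) → ℝ≥0∞ := fun z => D * (ENNReal.ofReal ((2:ℝ) ^ (-ε * |(j:ℝ) - z.1|)) *
    (((‖lam z.1 z.2‖₊ : ℝ≥0∞) * (2:ℝ≥0∞) ^ ((z.1:ℝ) * n / p.toReal)) *
      ENNReal.ofReal ((1 + ‖(2:ℝ)^z.1 • x - zpt z.2‖) ^ (-M)))) with hZ
  have h1 : (2 : ℝ≥0∞) ^ ((j : ℝ) * s) * (‖mOp (φ j) f x‖₊ : ℝ≥0∞) ≤ ∑' z, Z z := by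
    have e1 : mOp (φ j) f x = c0 • f.toFun ψ := rfl
    have e2 : (‖mOp (φ j) f x‖₊ : ℝ≥0∞) = ENNReal.ofReal c0 * ‖f.toFun ψ‖ₑ := by
      rw [e1]
      change ‖c0 • f.toFun ψ‖ₑ = _
      rw [enorm_smul, Real.enorm_of_nonneg hc0p]
    have e3 : ‖f.toFun ψ‖ₑ ≤ ∑' z : ℕ × (Fin n → ℤ), ‖lam z.1 z.2 • ∫ y, ψ y • a z.1 z.2 y‖ₑ := by
      rw [← (hrep ψ).tsum_eq]
      exact enorm_tsum_le_tsum_enorm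
    rw [e2]
    calc _ ≤ (2 : ℝ≥0∞) ^ ((j : ℝ) * s) * (ENNReal.ofReal c0 *
          ∑' z : ℕ × (Fin n → ℤ), ‖lam z.1 z.2 • ∫ y, ψ y • a z.1 z.2 y‖ₑ) :=
          mul_le_mul_right (mul_le_mul_right e3 _) _
      _ = ∑' z : ℕ × (Fin n → ℤ), (2 : ℝ≥0∞) ^ ((j : ℝ) * s) * (ENNReal.ofReal c0 *
           ‖lam z.1 z.2 • ∫ y, ψ y • a z.1 z.2 y‖ₑ) := by
          rw [ENNReal.tsum_mul_left, ENNReal.tsum_mul_left]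
      _ ≤ _ := by
          refine ENNReal.tsum_le_tsum fun z => ?_
          have h2 := ENNReal.ofReal_le_ofReal (hat z.1 z.2)
          rw [ENNReal.ofReal_mul (by positivity), ENNReal.ofReal_mul (by positivity),
            ENNReal.ofReal_mul (by positivity), ENNReal.ofReal_mul (by positivity),
            tl_two, tl_two (_ * _ / _), ofReal_norm] at h2
          calc _ = ENNReal.ofReal c0 * ‖lam z.1 z.2‖ₑ * ((2 : ℝ≥0∞) ^ ((j : ℝ) * s) *
                ‖∫ y, ψ y • a z.1 z.2 y‖ₑ) := by
                rw [enorm_smul]; ring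
            _ ≤ _ := mul_le_mul_right h2 _
            _ = Z z := by
                simp only [hZ, hD]
                rw [ENNReal.ofReal_mul hc0p]
                change _ = _ * (_ * ((‖lam z.1 z.2‖ₑ * _) * _))
                ring
  calc _ ≤ (∑' z, Z z) ^ w := ENNReal.rpow_le_rpow h1 hw.le
    _ ≤ ∑' z, Z z ^ w := tl_tsum_rpow _ hw hw1
    _ = ∑' (ν : ℕ) (m : Fin n → ℤ), D ^ w * (ENNReal.ofReal ((2:ℝ) ^ (-(ε*w) * |(j:ℝ) - ν|)) *
        (((‖lam ν m‖₊ : ℝ≥0∞) * (2:ℝ≥0∞) ^ ((ν:ℝ) * n / p.toReal)) ^ w *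
      ENNReal.ofReal ((1 + ‖(2:ℝ)^ν • x - zpt m‖) ^ (-(M*w))))) := by
        rw [ENNReal.tsum_prod']
        refine tsum_congr fun ν => tsum_congr fun m => ?_
        simp only [hZ]
        rw [ENNReal.mul_rpow_of_nonneg _ _ hw.le, ENNReal.mul_rpow_of_nonneg _ _ hw.le,
          ENNReal.mul_rpow_of_nonneg (_ * _) _ hw.le,
          ENNReal.ofReal_rpow_of_pos (x := (2:ℝ) ^ _) (by positivity),
          ENNReal.ofReal_rpow_of_pos (x := (1 + ‖_‖) ^ _) (by positivity),
          ← Real.rpow_mul (by norm_num), ← Real.rpow_mul (by positivity)]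
        have e6 : -ε * |(j:ℝ) - ν| * w = -(ε*w) * |(j:ℝ) - ν| := by ring
        have e7 : -M * w = -(M*w) := by ring
        rw [e6, e7]
    _ = D ^ w * ∑' ν : ℕ, ENNReal.ofReal ((2:ℝ) ^ (-(ε*w) * |(j:ℝ) - ν|)) *
        ∑' m, (((‖lam ν m‖₊ : ℝ≥0∞) * (2:ℝ≥0∞) ^ ((ν:ℝ) * n / p.toReal)) ^ w *
      ENNReal.ofReal ((1 + ‖(2:ℝ)^ν • x - zpt m‖) ^ (-(M*w)))) := by
        simp only [ENNReal.tsum_mul_left]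
    _ ≤ D ^ w * ∑' ν : ℕ, ENNReal.ofReal ((2:ℝ) ^ (-(ε*w) * |(j:ℝ) - ν|)) *
        (C1 * tlAv (M * w) ν (tlG w p lam ν) x) := by
        refine mul_le_mul_right (ENNReal.tsum_le_tsum fun ν => mul_le_mul_right ?_ _) _
        refine H1 ν _ _ ?_ x
        intro m y hy
        unfold tlG
        refine le_trans (le_of_eq ?_) (le_iSup _ m)
        simp [chiP, hy]
    _ = _ := by
        rw [mul_assoc, ← ENNReal.tsum_mul_left (a := C1)]
        congr 1
        refine tsum_congr fun ν => ?_
        ring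

lemma tl_lp_mono {p : ℝ≥0∞} (hp : 0 < p) (hp' : p ≠ ∞) {X Y : Rn n → ℝ≥0∞} {C : ℝ≥0∞}
    (h : ∫⁻ x, X x ^ p.toReal ≤ C * ∫⁻ x, Y x ^ p.toReal) :
    lpNormENN p X ≤ C ^ (1 / p.toReal) * lpNormENN p Y := by
  have hp0 : 0 < p.toReal := ENNReal.toReal_pos hp.ne' hp'
  simp only [lpNormENN, hp', if_false]
  rw [← ENNReal.mul_rpow_of_nonneg _ _ (by positivity)]
  exact ENNReal.rpow_le_rpow h (by positivity)

lemma tl_fin_case {p q : ℝ≥0∞} (hp : 0 < p) (hp' : p ≠ ∞) (hq : 0 < q) (hq' : q ≠ ∞)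
    {w N δ : ℝ} (hw : 0 < w) (hwp : w < p.toReal) (hwq : w < q.toReal) (hN : (n:ℝ) < N) (hδ : 0 < δ)
    {C : ℝ≥0∞} (hC : C ≠ ∞) :
    ∃ D : ℝ≥0∞, D ≠ ∞ ∧ ∀ (F : ℕ → Rn n → ℝ≥0∞) (lam : ℕ → (Fin n → ℤ) → ℂ),
      (∀ j x, F j x ^ w ≤ C * ∑' ν : ℕ, ENNReal.ofReal ((2:ℝ) ^ (-δ * |(j:ℝ) - ν|)) *
        tlAv N ν (tlG w p lam ν) x) →
      lpNormENN p (fun x => lqSum q fun j => F j x) ≤ D * fNorm p q lam := by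
  have hP : 0 < p.toReal := ENNReal.toReal_pos hp.ne' hp'
  have hQ : 0 < q.toReal := ENNReal.toReal_pos hq.ne' hq'
  set P := p.toReal with hPd
  set Q := q.toReal with hQd
  have hu : 1 < Q / w := (one_lt_div hw).2 hwq
  have hr : 1 < P / w := (one_lt_div hw).2 hwp
  have hru : P / w / (Q / w) = P / Q := by field_simp
  obtain ⟨C1, hC1, H1⟩ := tl_seq_young hδ hu
  obtain ⟨C2, hC2, H2⟩ := tl_V hN hu hr
  rw [hru] at H2
  have hPQ : 0 < P / Q := by positivity
  have hK1 : (C ^ (Q/w) * C1) ^ (P/Q) ≠ ∞ := ENNReal.rpow_ne_top_of_nonneg hPQ.le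
    (ENNReal.mul_ne_top (ENNReal.rpow_ne_top_of_nonneg (by positivity) hC) hC1)
  refine ⟨((C ^ (Q/w) * C1) ^ (P/Q) * C2) ^ (1/P), ENNReal.rpow_ne_top_of_nonneg (by positivity)
    (ENNReal.mul_ne_top hK1 hC2), ?_⟩
  intro F lam hF
  unfold fNorm
  refine tl_lp_mono hp hp' ?_
  simp only [lqSum, hq', if_false, ← hPd, ← hQd, ← ENNReal.rpow_mul]
  have e0 : 1 / Q * P = P / Q := by ring
  rw [e0]
  calc ∫⁻ x, (∑' j, F j x ^ Q) ^ (P/Q)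
      ≤ ∫⁻ x, (C ^ (Q/w) * C1) ^ (P/Q) * (∑' ν, tlAv N ν (tlG w p lam ν) x ^ (Q/w)) ^ (P/Q) := by
        refine lintegral_mono fun x => ?_
        dsimp only
        rw [← ENNReal.mul_rpow_of_nonneg _ _ hPQ.le]
        refine ENNReal.rpow_le_rpow ?_ hPQ.le
        calc ∑' j, F j x ^ Q ≤ ∑' j : ℕ, (C * ∑' ν : ℕ, ENNReal.ofReal ((2:ℝ) ^ (-δ * |(j:ℝ) - ν|)) *
              tlAv N ν (tlG w p lam ν) x) ^ (Q/w) := by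
              refine ENNReal.tsum_le_tsum fun j => ?_
              have : F j x ^ Q = (F j x ^ w) ^ (Q/w) := by
                rw [← ENNReal.rpow_mul]; congr 1; field_simp
              rw [this]
              exact ENNReal.rpow_le_rpow (hF j x) (by positivity)
          _ = C ^ (Q/w) * ∑' j : ℕ, (∑' ν : ℕ, ENNReal.ofReal ((2:ℝ) ^ (-δ * |(j:ℝ) - ν|)) *
              tlAv N ν (tlG w p lam ν) x) ^ (Q/w) := by
              rw [← ENNReal.tsum_mul_left]
              refine tsum_congr fun j => ?_
              rw [ENNReal.mul_rpow_of_nonneg _ _ (by positivity)]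
          _ ≤ _ := by
              rw [mul_assoc]
              exact mul_le_mul_right (H1 _) _
    _ = (C ^ (Q/w) * C1) ^ (P/Q) * ∫⁻ x, (∑' ν, tlAv N ν (tlG w p lam ν) x ^ (Q/w)) ^ (P/Q) :=
        lintegral_const_mul' _ _ hK1
    _ ≤ (C ^ (Q/w) * C1) ^ (P/Q) * (C2 * ∫⁻ x, (∑' ν, tlG w p lam ν x ^ (Q/w)) ^ (P/Q)) :=
        mul_le_mul_right (H2 _ (tlG_meas w p lam)) _
    _ ≤ _ := by
        rw [← mul_assoc]
        refine mul_le_mul_right (lintegral_mono fun x => ?_) _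
        refine ENNReal.rpow_le_rpow (ENNReal.tsum_le_tsum fun ν => ?_) hPQ.le
        have h3 : tlG w p lam ν x ≤
            (∑' m, ((‖lam ν m‖₊ : ℝ≥0∞) * chiP p ν m x) ^ Q) ^ (w/Q) := by
          refine iSup_le fun m => ?_
          have : ((‖lam ν m‖₊ : ℝ≥0∞) * chiP p ν m x) ^ w =
              (((‖lam ν m‖₊ : ℝ≥0∞) * chiP p ν m x) ^ Q) ^ (w/Q) := by
            rw [← ENNReal.rpow_mul]; congr 1; field_simp
          rw [this]
          exact ENNReal.rpow_le_rpow (ENNReal.le_tsum m) (by positivity)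
        refine (ENNReal.rpow_le_rpow h3 (by positivity)).trans (le_of_eq ?_)
        rw [← ENNReal.rpow_mul]
        have : w / Q * (Q / w) = 1 := by field_simp
        rw [this, ENNReal.rpow_one]

lemma tl_top_case {p : ℝ≥0∞} (hp : 0 < p) (hp' : p ≠ ∞)
    {w N δ : ℝ} (hw : 0 < w) (hwp : w < p.toReal) (hN : (n:ℝ) < N) (hδ : 0 < δ)
    {C : ℝ≥0∞} (hC : C ≠ ∞) :
    ∃ D : ℝ≥0∞, D ≠ ∞ ∧ ∀ (F : ℕ → Rn n → ℝ≥0∞) (lam : ℕ → (Fin n → ℤ) → ℂ),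
      (∀ j x, F j x ^ w ≤ C * ∑' ν : ℕ, ENNReal.ofReal ((2:ℝ) ^ (-δ * |(j:ℝ) - ν|)) *
        tlAv N ν (tlG w p lam ν) x) →
      lpNormENN p (fun x => lqSum ∞ fun j => F j x) ≤ D * fNorm p ∞ lam := by
  have hP : 0 < p.toReal := ENNReal.toReal_pos hp.ne' hp'
  set P := p.toReal with hPd
  have hr : 1 < P / w := (one_lt_div hw).2 hwp
  obtain ⟨C1, hC1, H1⟩ := tl_conv_seq hδ
  obtain ⟨C2, hC2, H2⟩ := tl_V_top hN hr
  have hK1 : (C * C1) ^ (P/w) ≠ ∞ := ENNReal.rpow_ne_top_of_nonneg (by positivity)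
    (ENNReal.mul_ne_top hC hC1)
  refine ⟨((C * C1) ^ (P/w) * C2) ^ (1/P), ENNReal.rpow_ne_top_of_nonneg (by positivity)
    (ENNReal.mul_ne_top hK1 hC2), ?_⟩
  intro F lam hF
  unfold fNorm
  refine tl_lp_mono hp hp' ?_
  simp only [lqSum, if_true, ← hPd]
  calc ∫⁻ x, (⨆ j, F j x) ^ P
      ≤ ∫⁻ x, (C * C1) ^ (P/w) * (⨆ ν, tlAv N ν (tlG w p lam ν) x) ^ (P/w) := by
        refine lintegral_mono fun x => ?_
        dsimp only
        rw [← ENNReal.mul_rpow_of_nonneg _ _ (by positivity)]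
        have h3 : ⨆ j, F j x ≤ (C * C1 * ⨆ ν, tlAv N ν (tlG w p lam ν) x) ^ (1/w) := by
          refine iSup_le fun j => ?_
          have h4 : F j x = (F j x ^ w) ^ (1/w) := by
            rw [← ENNReal.rpow_mul, mul_one_div_cancel hw.ne', ENNReal.rpow_one]
          rw [h4]
          refine ENNReal.rpow_le_rpow ?_ (by positivity)
          refine (hF j x).trans ?_
          rw [mul_assoc]
          refine mul_le_mul_right ?_ _
          calc _ ≤ ∑' ν : ℕ, ENNReal.ofReal ((2:ℝ) ^ (-δ * |(j:ℝ) - ν|)) *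
                ⨆ ν, tlAv N ν (tlG w p lam ν) x :=
                ENNReal.tsum_le_tsum fun ν => mul_le_mul_right
                  (le_iSup (fun ν => tlAv N ν (tlG w p lam ν) x) ν) _
            _ ≤ _ := by
                rw [ENNReal.tsum_mul_right]
                exact mul_le_mul_left (H1 j) _
        refine (ENNReal.rpow_le_rpow h3 hP.le).trans (le_of_eq ?_)
        rw [← ENNReal.rpow_mul]
        congr 1
        ring
    _ = (C * C1) ^ (P/w) * ∫⁻ x, (⨆ ν, tlAv N ν (tlG w p lam ν) x) ^ (P/w) :=
        lintegral_const_mul' _ _ hK1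
    _ ≤ (C * C1) ^ (P/w) * (C2 * ∫⁻ x, (⨆ ν, tlG w p lam ν x) ^ (P/w)) :=
        mul_le_mul_right (H2 _ (tlG_meas w p lam)) _
    _ ≤ _ := by
        rw [← mul_assoc]
        refine mul_le_mul_right (lintegral_mono fun x => ?_) _
        have h3 : ⨆ ν, tlG w p lam ν x ≤
            (⨆ (ν : ℕ) (m : Fin n → ℤ), (‖lam ν m‖₊ : ℝ≥0∞) * chiP p ν m x) ^ w := by
          refine iSup_le fun ν => iSup_le fun m => ENNReal.rpow_le_rpow ?_ hw.le
          exact le_iSup₂ (f := fun (ν : ℕ) (m : Fin n → ℤ) => (‖lam ν m‖₊ : ℝ≥0∞) * chiP p ν m x) ν m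
        refine (ENNReal.rpow_le_rpow h3 (by positivity)).trans (le_of_eq ?_)
        rw [← ENNReal.rpow_mul]
        congr 1
        field_simp

end TLFinal

/-- an atomic decomposition with `f_{p,q}`-coefficients lies in
`F^s_{p,q}(E)`, with norm controlled by `‖λ|f_{p,q}‖` uniformly in the representation. -/
theorem statement14 (n : ℕ) (E : Type*) [NormedAddCommGroup E] [NormedSpace ℂ E]
    [CompleteSpace E] (s : ℝ) (p q : ℝ≥0∞) (hp : 0 < p) (hp' : p ≠ ∞) (hq : 0 < q)
    (d : ℝ) (hd : 1 < d) (K : ℕ) (L : ℤ) (hL : -1 ≤ L)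
    (hK : 1 + ⌊s⌋ ≤ (K : ℤ)) (hLs : ⌊sigmaPQ n p q - s⌋ ≤ L)
    (φ : ℕ → Sch n) (hφ : SmoothResolution n φ) :
    ∃ c > (0 : ℝ), ∀ (f : TDist n E) (lam : ℕ → (Fin n → ℤ) → ℂ)
        (a : ℕ → (Fin n → ℤ) → Rn n → E),
      (∀ m, Is1Atom K d m (a 0 m)) →
      (∀ ν m, 0 < ν → IsSPAtom s p K L d ν m (a ν m)) →
      fNorm p q lam < ∞ →
      RepresentsAtomic f lam a →
      triebelNorm s p q φ f < ∞ ∧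
        triebelNorm s p q φ f ≤ ENNReal.ofReal c * fNorm p q lam := by
  have hKs : s < K := by
    have h1 : (1 + ⌊s⌋ : ℝ) ≤ K := by exact_mod_cast hK
    linarith [Int.lt_floor_add_one s]
  have hLs' : sigmaPQ n p q - s < L + 1 := by
    have h1 : ((⌊sigmaPQ n p q - s⌋ : ℤ) : ℝ) ≤ L := by exact_mod_cast hLs
    linarith [Int.lt_floor_add_one (sigmaPQ n p q - s)]
  set t := (min p q).toReal with ht
  have hmt : min p q ≠ ∞ := ((min_le_left p q).trans_lt (lt_top_iff_ne_top.2 hp')).ne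
  have ht0 : 0 < t := ENNReal.toReal_pos (lt_min hp hq).ne' hmt
  have htp : t ≤ p.toReal := ENNReal.toReal_mono hp' (min_le_left _ _)
  have htq : q ≠ ∞ → t ≤ q.toReal := fun h => ENNReal.toReal_mono h (min_le_right _ _)
  have hm0 : 0 < min 1 t := lt_min one_pos ht0
  have hn0 : (0:ℝ) ≤ n := Nat.cast_nonneg n
  have hnm : (n:ℝ) / min 1 t ≤ n + sigmaPQ n p q := by
    unfold sigmaPQ
    rw [← ht]
    rcases le_total 1 t with h | h
    · rw [min_eq_left h, div_one]
      linarith [le_max_right ((n:ℝ) * (1/t - 1)) 0]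
    · rw [min_eq_right h]
      have e : (n:ℝ) / t = n + n * (1/t - 1) := by ring
      linarith [le_max_left ((n:ℝ) * (1/t - 1)) 0]
  obtain ⟨M, hM1, hM2⟩ := exists_between (show (n:ℝ) / min 1 t < L + 1 + n + s by linarith)
  have hM0 : 0 < M := lt_of_le_of_lt (by positivity) hM1
  have hMn : (n:ℝ) / M < min 1 t := by
    rw [div_lt_iff₀ hm0] at hM1
    rw [div_lt_iff₀ hM0]
    linarith
  obtain ⟨w, hw1, hw2⟩ := exists_between hMn
  have hw0 : 0 < w := lt_of_le_of_lt (by positivity) hw1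
  have hN : (n:ℝ) < M * w := by
    rw [div_lt_iff₀ hM0] at hw1
    linarith
  have hwt : w < t := hw2.trans_le (min_le_right _ _)
  have hwo : w ≤ 1 := (hw2.trans_le (min_le_left _ _)).le
  obtain ⟨δ, hδ, C, hC, H⟩ := tl_ptwise (E := E) (p := p) hφ hd hL hKs hM0.le hM2 hw0 hwo
  have key : ∃ D : ℝ≥0∞, D ≠ ∞ ∧ ∀ (F : ℕ → Rn n → ℝ≥0∞) (lam : ℕ → (Fin n → ℤ) → ℂ),
      (∀ j x, F j x ^ w ≤ C * ∑' ν : ℕ, ENNReal.ofReal ((2:ℝ) ^ (-δ * |(j:ℝ) - ν|)) *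
        tlAv (M * w) ν (tlG w p lam ν) x) →
      lpNormENN p (fun x => lqSum q fun j => F j x) ≤ D * fNorm p q lam := by
    by_cases hq' : q = ∞
    · subst hq'
      exact tl_top_case hp hp' hw0 (hwt.trans_le htp) hN hδ hC
    · exact tl_fin_case hp hp' hq hq' hw0 (hwt.trans_le htp) (hwt.trans_le (htq hq')) hN hδ hC
  obtain ⟨D, hD, HD⟩ := key
  refine ⟨D.toReal + 1, by positivity, ?_⟩
  intro f lam a ha0 ha1 hfin hrep
  have hmain : triebelNorm s p q φ f ≤ ENNReal.ofReal (D.toReal + 1) * fNorm p q lam := by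
    refine (HD (fun j x => (2 : ℝ≥0∞) ^ ((j : ℝ) * s) * (‖mOp (φ j) f x‖₊ : ℝ≥0∞)) lam
      (H f lam a ha0 ha1 hrep)).trans ?_
    refine mul_le_mul_left ?_ _
    rw [ENNReal.le_ofReal_iff_toReal_le hD (by positivity)]
    linarith
  exact ⟨hmain.trans_lt (ENNReal.mul_lt_top ENNReal.ofReal_lt_top hfin), hmain⟩

end
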